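/- Let X ⊂ P^8 be a non-singular hypersurface of degree d ∈ {3,4}. Suppose that for some x ∈ X the cone C_x^3 = C_x(F_3(X)), the union of all 3-planes contained in X passing through x, has dimension 6. Then necessarily d = 4 and the variety G_x = {T ∈ F_3(X) : x ∈ T} of 3-planes of X through x has dimension 3. -/

import Mathlib

noncomputable section

abbrev KK : Type := AlgebraicClosure ℚ

abbrev Pn (N : ℕ) := Projectivization KK (Fin (N + 1) → KK)

/-- The common zero set in projective space of a family of polynomials
(membership tested on the chosen representative). -/
def projZeros {N : ℕ} (S : Set (MvPolynomial (Fin (N + 1)) KK)) : Set (Pn N) :=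
  {x | ∀ f ∈ S, MvPolynomial.eval x.rep f = 0}

/-- Zariski-closed subsets of projective space: common zero sets of families of forms. -/
def ProjClosed {N : ℕ} (V : Set (Pn N)) : Prop :=
  ∃ S : Set (MvPolynomial (Fin (N + 1)) KK),
    (∀ f ∈ S, ∃ d, f.IsHomogeneous d) ∧ V = projZeros S

def ProjIrred {N : ℕ} (V : Set (Pn N)) : Prop :=
  V.Nonempty ∧ ∀ C₁ C₂ : Set (Pn N), ProjClosed C₁ → ProjClosed C₂ →
    V ⊆ C₁ ∪ C₂ → V ⊆ C₁ ∨ V ⊆ C₂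

/-- A (geometrically integral) projective variety: an irreducible Zariski-closed set. -/
def ProjVariety {N : ℕ} (V : Set (Pn N)) : Prop := ProjClosed V ∧ ProjIrred V

/-- Dimension of a subset of projective space: Krull dimension of the poset of
irreducible closed subsets contained in it. The empty set has dimension `⊥`. -/
def projDim {N : ℕ} (V : Set (Pn N)) : WithBot ENat :=
  Order.krullDim {W : Set (Pn N) // ProjVariety W ∧ W ⊆ V}

/-- The set of projective points lying on a linear subspace. -/
def planeSet {N : ℕ} (W : Submodule KK (Fin (N + 1) → KK)) : Set (Pn N) :=
  {x | x.rep ∈ W}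

/-- Degree of a subset of projective space: the largest (finite) number of points
in a linear section. -/
def projDeg {N : ℕ} (V : Set (Pn N)) : ℕ :=
  sSup {k : ℕ | ∃ W : Submodule KK (Fin (N + 1) → KK),
    (V ∩ planeSet W).Finite ∧ (V ∩ planeSet W).ncard = k}

/-- The hypersurface cut out by a form. -/
def hyp {n : ℕ} (F : MvPolynomial (Fin (n + 1)) KK) : Set (Pn n) :=
  {x | MvPolynomial.eval x.rep F = 0}

/-- A form over the algebraic closure is non-singular if its partial derivatives
have no common non-trivial zero. -/
def NonsingularK {n : ℕ} (F : MvPolynomial (Fin (n + 1)) KK) : Prop :=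
  ∀ z : Fin (n + 1) → KK,
    (∀ i, MvPolynomial.eval z (MvPolynomial.pderiv i F) = 0) → z = 0

/-- The Fano set of (projective) m-planes contained in X, as linear subspaces of
dimension m+1. -/
def Fano (m n : ℕ) (X : Set (Pn n)) : Set (Submodule KK (Fin (n + 1) → KK)) :=
  {W | Module.finrank KK W = m + 1 ∧ planeSet W ⊆ X}

/-- Closed subsets of the Grassmannian of m-planes in Pⁿ, described via Stiefel
coordinates: Z is closed iff the set of (m+1)-tuples of vectors which, when
linearly independent, span a member of Z, is Zariski-closed in affine space. -/
def GrClosed (m n : ℕ) (Z : Set (Submodule KK (Fin (n + 1) → KK))) : Prop :=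
  (∀ W ∈ Z, Module.finrank KK W = m + 1) ∧
  ∃ S : Set (MvPolynomial (Fin (m + 1) × Fin (n + 1)) KK),
    {v : Fin (m + 1) → Fin (n + 1) → KK |
      LinearIndependent KK v → Submodule.span KK (Set.range v) ∈ Z}
    = {v | ∀ f ∈ S, MvPolynomial.eval (fun p => v p.1 p.2) f = 0}

def GrIrred (m n : ℕ) (Z : Set (Submodule KK (Fin (n + 1) → KK))) : Prop :=
  Z.Nonempty ∧ ∀ C₁ C₂ : Set (Submodule KK (Fin (n + 1) → KK)),
    GrClosed m n C₁ → GrClosed m n C₂ → Z ⊆ C₁ ∪ C₂ → Z ⊆ C₁ ∨ Z ⊆ C₂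

/-- A (geometrically integral) subvariety of the Grassmannian. -/
def GrVariety (m n : ℕ) (Z : Set (Submodule KK (Fin (n + 1) → KK))) : Prop :=
  GrClosed m n Z ∧ GrIrred m n Z

/-- Dimension of a subset of the Grassmannian of m-planes in Pⁿ. -/
def grDim (m n : ℕ) (Z : Set (Submodule KK (Fin (n + 1) → KK))) : WithBot ENat :=
  Order.krullDim {W : Set (Submodule KK (Fin (n + 1) → KK)) // GrVariety m n W ∧ W ⊆ Z}

/-- D(Z): the union of the planes parametrised by Z. -/
def DSet {n : ℕ} (Z : Set (Submodule KK (Fin (n + 1) → KK))) : Set (Pn n) :=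
  {x | ∃ Λ ∈ Z, x.rep ∈ Λ}

/-- A primitive integer vector: the gcd of its coordinates is 1. -/
def IsPrimitiveVec {n : ℕ} (x : Fin n → ℤ) : Prop := Finset.univ.gcd x = 1

/-- Height of an integer vector: the maximum modulus of its coordinates. -/
def heightVec {n : ℕ} (x : Fin n → ℤ) : ℝ :=
  ((Finset.univ.sup fun i => (x i).natAbs : ℕ) : ℝ)

def coeK {n : ℕ} (x : Fin n → ℤ) : Fin n → KK := fun i => ((x i : ℤ) : KK)

def coeQ {n : ℕ} (x : Fin n → ℤ) : Fin n → ℚ := fun i => ((x i : ℤ) : ℚ)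

/-- The number of rational points of height at most B on a subset V of projective
space, counted via primitive integer vectors (each projective rational point
corresponds to exactly two primitive vectors). -/
def NV {n : ℕ} (V : Set (Pn n)) (B : ℝ) : ℕ :=
  Set.ncard {x : Fin (n + 1) → ℤ | IsPrimitiveVec x ∧ heightVec x ≤ B ∧
    ∃ h : coeK x ≠ 0, Projectivization.mk KK (coeK x) h ∈ V}

/-- An integer form is non-singular if its partial derivatives have no common
non-trivial zero over the algebraic closure of ℚ. -/
def NonsingularZ {n : ℕ} (F : MvPolynomial (Fin (n + 1)) ℤ) : Prop :=
  ∀ z : Fin (n + 1) → KK,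
    (∀ i, MvPolynomial.aeval z (MvPolynomial.pderiv i F) = 0) → z = 0

/-- Base change of an integer polynomial to the algebraic closure of ℚ. -/
def mapK {n : ℕ} (F : MvPolynomial (Fin (n + 1)) ℤ) : MvPolynomial (Fin (n + 1)) KK :=
  MvPolynomial.map (Int.castRingHom KK) F

/-- The Plücker height of the rational m-plane spanned by the integer vectors v:
the maximum modulus of the (m+1)×(m+1) minors, divided by their gcd. -/
def pluckerHeight {m n : ℕ} (v : Fin (m + 1) → Fin (n + 1) → ℤ) : ℕ :=
  (Finset.univ.sup fun s : Fin (m + 1) → Fin (n + 1) =>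
    (Matrix.det (Matrix.of fun i j => v i (s j))).natAbs) /
  (Finset.univ.gcd fun s : Fin (m + 1) → Fin (n + 1) =>
    (Matrix.det (Matrix.of fun i j => v i (s j))).natAbs)

def betaExp (k : ℕ) : ℝ := if k ≤ 3 then 0 else 1/4

def sigmaExp (n k : ℕ) : ℝ :=
  if (k : ℝ) ≤ ((n : ℝ) - 1) / 2 then (k : ℝ) + 1 else (k : ℝ) + betaExp k

def tauExp (n k : ℕ) : ℝ :=
  if (k : ℝ) < ((n : ℝ) - 1) / 2 then (k : ℝ) + 1 else (k : ℝ) + betaExp k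

/-- E: the union of the (n-1)/2-planes contained in X (for n odd; empty for n even). -/
def bigE {n : ℕ} (X : Set (Pn n)) : Set (Pn n) :=
  {x | n % 2 = 1 ∧ ∃ W : Submodule KK (Fin (n + 1) → KK),
    Module.finrank KK W = (n - 1) / 2 + 1 ∧ planeSet W ⊆ X ∧ x ∈ planeSet W}

/-- The cone of lines contained in X passing through x. -/
def coneOfLines {n : ℕ} (X : Set (Pn n)) (x : Pn n) : Set (Pn n) :=
  {y | ∃ L : Submodule KK (Fin (n + 1) → KK),
    Module.finrank KK L = 2 ∧ planeSet L ⊆ X ∧ x.rep ∈ L ∧ y.rep ∈ L}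



open MvPolynomial in
theorem aux_prime_lt {R : Type*} [CommRing R] [IsNoetherianRing R] {n : ℕ}
    (c : Fin (n + 1) → Ideal R) (hp : ∀ i, (c i).IsPrime)
    (hc : ∀ i : Fin n, c i.castSucc < c i.succ)
    (s : Finset R) (hs : ∀ f ∈ s, f ∈ c (Fin.last n)) (hcard : s.card < n) :
    ∃ p : Ideal R, p.IsPrime ∧ (∀ f ∈ s, f ∈ p) ∧ p < c (Fin.last n) := by
  have := hp (Fin.last n)
  have hle : Ideal.span (s : Set R) ≤ c (Fin.last n) := by
    rw [Ideal.span_le]; exact hs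
  obtain ⟨p, hpm, hpl⟩ := Ideal.exists_minimalPrimes_le hle
  refine ⟨p, hpm.1.1, fun f hf => hpm.1.2 (Ideal.subset_span hf), lt_of_le_of_ne hpl ?_⟩
  rintro rfl
  have h1 := Ideal.height_le_card_of_mem_minimalPrimes_span_finset hpm
  let q : LTSeries (PrimeSpectrum R) :=
    { length := n
      toFun := fun i => ⟨c i, hp i⟩
      step := fun i => hc i }
  have h2 : (n : ℕ∞) ≤ Order.height (⟨c (Fin.last n), hp _⟩ : PrimeSpectrum R) :=
    Order.length_le_height_last (p := q)
  rw [← PrimeSpectrum.height_eq_orderHeight] at h2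
  have h3 := h2.trans h1
  norm_cast at h3
  omega

open MvPolynomial in
/-- Fewer than `n` polynomials vanishing at the origin of `k^n` have another common zero. -/
theorem aux_common_zero {k : Type*} [Field k] [IsAlgClosed k] {n : ℕ}
    (s : Finset (MvPolynomial (Fin n) k)) (hs : ∀ f ∈ s, eval 0 f = 0) (hcard : s.card < n) :
    ∃ a : Fin n → k, a ≠ 0 ∧ ∀ f ∈ s, eval a f = 0 := by
  let φ : ℕ → (MvPolynomial (Fin n) k →ₐ[k] MvPolynomial (Fin n) k) := fun i =>
    aeval (fun j : Fin n => if j.val < i then 0 else X j)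
  have hφ : ∀ i, (φ (i+1)).comp (φ i) = φ (i+1) := by
    intro i
    apply MvPolynomial.algHom_ext
    intro j
    simp only [φ, AlgHom.comp_apply, aeval_X]
    by_cases h : j.val < i
    · simp [h, Nat.lt_succ_of_lt h]
    · simp [h]
  have hlast : ∀ f, φ n f = C (eval 0 f) := by
    intro f
    have : φ n = (Algebra.ofId k _).comp (aeval (0 : Fin n → k)) := by
      apply MvPolynomial.algHom_ext
      intro j
      simp [φ]
    rw [this]
    simp [Algebra.ofId_apply, MvPolynomial.algebraMap_eq, aeval_eq_eval]
  obtain ⟨p, hp, hsp, hlt⟩ := aux_prime_lt (n := n)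
    (fun i => RingHom.ker (φ i.val)) (fun i => RingHom.ker_isPrime _) (by
      intro i
      refine lt_of_le_of_ne ?_ ?_
      · intro f hf
        rw [RingHom.mem_ker] at hf ⊢
        simp only [Fin.val_succ, Fin.val_castSucc] at *
        rw [← hφ, AlgHom.comp_apply, hf, map_zero]
      · intro h
        have h1 : (X i : MvPolynomial (Fin n) k) ∈ RingHom.ker (φ i.succ.val) := by
          rw [RingHom.mem_ker]; simp [φ]
        rw [← h, RingHom.mem_ker] at h1
        simp [φ] at h1) s (by
      intro f hf
      rw [RingHom.mem_ker]
      simp only [Fin.val_last]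
      rw [hlast, hs f hf, map_zero]) hcard
  obtain ⟨f, hfm, hfp⟩ := SetLike.exists_of_lt hlt
  rw [RingHom.mem_ker] at hfm
  simp only [Fin.val_last] at hfm
  rw [hlast, ← map_zero C] at hfm
  have hf0 := C_injective _ _ hfm
  rw [← MvPolynomial.IsPrime.vanishingIdeal_zeroLocus (K := k) p, mem_vanishingIdeal_iff] at hfp
  push Not at hfp
  obtain ⟨a, ha, hfa⟩ := hfp
  refine ⟨a, ?_, fun g hg => ?_⟩
  · rintro rfl
    exact hfa (by rw [aeval_eq_eval]; exact hf0)
  · have := (mem_zeroLocus_iff.mp ha) g (hsp g hg)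
    rwa [aeval_eq_eval] at this

open MvPolynomial in
/-- Bilinear maps `k^3 × k^3 → k^4` have a non-trivial zero. -/
theorem aux_hopf {k : Type*} [Field k] [IsAlgClosed k] {H : Type*} [AddCommGroup H] [Module k H]
    [FiniteDimensional k H] (hH : Module.finrank k H = 4) (B : Fin 3 → Fin 3 → H) :
    ∃ u p : Fin 3 → k, u ≠ 0 ∧ p ≠ 0 ∧ ∑ i, ∑ j, (u i * p j) • B i j = 0 := by
  classical
  let bas := Module.finBasisOfFinrankEq k H hH
  let φ : MvPolynomial (Fin 3 × Fin 3) k →ₐ[k] MvPolynomial (Fin 3 ⊕ Fin 3) k :=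
    aeval (fun z => X (Sum.inl z.1) * X (Sum.inr z.2))
  -- order in which the variables are killed
  let w : Fin 3 ⊕ Fin 3 → ℕ := Sum.elim ![4, 3, 2] ![4, 1, 0]
  let ψ : ℕ → (MvPolynomial (Fin 3 ⊕ Fin 3) k →ₐ[k] MvPolynomial (Fin 3 ⊕ Fin 3) k) := fun i => aeval (fun v => if w v < i then 0 else X v)
  have hψ : ∀ i, (ψ (i+1)).comp (ψ i) = ψ (i+1) := by
    intro i
    apply MvPolynomial.algHom_ext
    intro j
    simp only [ψ, AlgHom.comp_apply, aeval_X]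
    by_cases h : w j < i
    · simp [h, Nat.lt_succ_of_lt h]
    · simp [h]
  have hw : ∀ v, w v < 5 := by
    rintro (v | v) <;> fin_cases v <;> simp [w]
  have hlast : ∀ f, ψ 5 f = C (eval 0 f) := by
    intro f
    have : ψ 5 = (Algebra.ofId k _).comp (aeval (0 : Fin 3 ⊕ Fin 3 → k)) := by
      apply MvPolynomial.algHom_ext
      intro j
      simp [ψ, hw]
    rw [this]
    simp [Algebra.ofId_apply, MvPolynomial.algebraMap_eq, aeval_eq_eval]
  let R := φ.range
  have hNoeth : IsNoetherianRing R := AlgHom.isNoetherianRing_range φ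
  let lin : Fin 4 → MvPolynomial (Fin 3 × Fin 3) k := fun t =>
    ∑ i, ∑ j, C (bas.repr (B i j) t) * X (i, j)
  let s : Finset R := Finset.univ.image (fun t : Fin 4 => φ.rangeRestrict (lin t))
  have hφ0 : ∀ f, eval 0 (φ f) = eval 0 f := by
    intro f
    have : (aeval (0 : Fin 3 ⊕ Fin 3 → k)).comp φ = aeval (0 : Fin 3 × Fin 3 → k) := by
      apply MvPolynomial.algHom_ext
      intro j
      simp [φ]
    have h2 := DFunLike.congr_fun this f
    simpa [aeval_eq_eval] using h2
  obtain ⟨p, hp, hsp, hlt⟩ := aux_prime_lt (n := 5)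
    (fun i => (RingHom.ker (ψ i.val)).comap R.val) (fun i => by
      have : (RingHom.ker (ψ i.val)).IsPrime := RingHom.ker_isPrime _
      exact Ideal.IsPrime.comap _) (by
      intro i
      refine lt_of_le_of_ne ?_ ?_
      · intro f hf
        rw [Ideal.mem_comap, RingHom.mem_ker] at hf ⊢
        simp only [Fin.val_succ, Fin.val_castSucc] at *
        rw [← hψ, AlgHom.comp_apply, hf, map_zero]
      · intro h
        have key : ∀ z : Fin 3 × Fin 3, (w (Sum.inl z.1) < i.val + 1 ∨ w (Sum.inr z.2) < i.val + 1) →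
            (w (Sum.inl z.1) < i.val ∨ w (Sum.inr z.2) < i.val) := by
          intro z hz
          have h1 : φ.rangeRestrict (X z) ∈ (RingHom.ker (ψ i.succ.val)).comap R.val := by
            rw [Ideal.mem_comap, RingHom.mem_ker]
            change ψ (i.val + 1) (φ (X z)) = 0
            simp only [φ, ψ, aeval_X, map_mul]
            rcases hz with hz | hz
            · rw [if_pos hz, zero_mul]
            · rw [if_pos hz, mul_zero]
          rw [← h, Ideal.mem_comap, RingHom.mem_ker] at h1
          change ψ i.val (φ (X z)) = 0 at h1
          simp only [φ, ψ, aeval_X, map_mul] at h1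
          by_contra hcon
          push Not at hcon
          rw [if_neg (not_lt.mpr hcon.1), if_neg (not_lt.mpr hcon.2)] at h1
          exact mul_ne_zero (X_ne_zero _) (X_ne_zero _) h1
        fin_cases i
        · have := key (0, 2); simp [w] at this
        · have := key (0, 1); simp [w] at this
        · have := key (2, 0); simp [w] at this
        · have := key (1, 0); simp [w] at this
        · have := key (0, 0); simp [w] at this) s (by
      intro f hf
      simp only [s, Finset.mem_image, Finset.mem_univ, true_and] at hf
      obtain ⟨t, rfl⟩ := hf
      rw [Ideal.mem_comap, RingHom.mem_ker]
      change ψ 5 (φ (lin t)) = 0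
      rw [hlast, hφ0]
      simp [lin]) (lt_of_le_of_lt Finset.card_image_le (by simp))
  obtain ⟨r, hrm, hrp⟩ := SetLike.exists_of_lt hlt
  obtain ⟨f, rfl⟩ := φ.rangeRestrict_surjective r
  rw [Ideal.mem_comap, RingHom.mem_ker] at hrm
  change ψ 5 (φ f) = 0 at hrm
  rw [hlast, hφ0, ← map_zero C] at hrm
  have hf0 := C_injective _ _ hrm
  let P : Ideal (MvPolynomial (Fin 3 × Fin 3) k) := p.comap φ.rangeRestrict
  have hP : P.IsPrime := Ideal.IsPrime.comap _
  have hfp : f ∉ P := hrp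
  rw [← MvPolynomial.IsPrime.vanishingIdeal_zeroLocus (K := k) P, mem_vanishingIdeal_iff] at hfp
  push Not at hfp
  obtain ⟨z, hz, hfz⟩ := hfp
  have hz0 : z ≠ 0 := by
    rintro rfl
    exact hfz (by rw [aeval_eq_eval]; exact hf0)
  obtain ⟨⟨a, b⟩, hab⟩ : ∃ ab, z ab ≠ 0 := by
    by_contra hcon
    push Not at hcon
    exact hz0 (funext hcon)
  have hzP : ∀ g, g ∈ P → eval z g = 0 := by
    intro g hg
    have := (mem_zeroLocus_iff.mp hz) g hg
    rwa [aeval_eq_eval] at this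
  have hminor : ∀ i j, z (i, b) * z (a, j) = z (a, b) * z (i, j) := by
    intro i j
    have : (X (i, b) * X (a, j) - X (a, b) * X (i, j) : MvPolynomial (Fin 3 × Fin 3) k) ∈ P := by
      change φ.rangeRestrict _ ∈ p
      convert p.zero_mem
      apply Subtype.ext
      change φ _ = 0
      simp only [φ, map_sub, map_mul, aeval_X]
      ring
    have h2 := hzP _ this
    simp only [map_sub, map_mul, eval_X] at h2
    exact sub_eq_zero.mp h2
  refine ⟨fun i => z (i, b), fun j => z (a, j), ?_, ?_, ?_⟩
  · intro h; exact hab (congrFun h a)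
  · intro h; exact hab (congrFun h b)
  · simp only [hminor]
    apply bas.repr.injective
    ext t
    have h1 : lin t ∈ P := hsp _ (Finset.mem_image.mpr ⟨t, Finset.mem_univ _, rfl⟩)
    have h2 := hzP _ h1
    simp only [lin, map_sum, map_mul, eval_C, eval_X] at h2
    simp only [map_sum, map_smul, Finsupp.coe_finsetSum, Finset.sum_apply, Finsupp.smul_apply,
      smul_eq_mul, map_zero, Finsupp.coe_zero, Pi.zero_apply]
    simp only [mul_assoc, ← Finset.mul_sum]
    convert mul_zero (z (a, b)) using 2
    rw [← h2]
    simp only [mul_comm]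

open MvPolynomial in
/-- A factor of a nonzero homogeneous polynomial is homogeneous. -/
theorem aux_hom_factor {σ k : Type*} [Field k] {f h : MvPolynomial σ k} {e : ℕ}
    (hfh : (f * h).IsHomogeneous e) (hne : f * h ≠ 0) :
    ∃ a b, f.IsHomogeneous a ∧ h.IsHomogeneous b ∧ a + b = e := by
  classical
  let φ : MvPolynomial σ k →ₐ[k] Polynomial (MvPolynomial σ k) :=
    aeval (fun i => Polynomial.C (X i) * Polynomial.X)
  have hmon : ∀ (d : σ →₀ ℕ) (r : k), φ (monomial d r) = Polynomial.monomial d.degree (monomial d r) := by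
    intro d r
    simp only [φ, aeval_monomial, mul_pow]
    rw [Finsupp.prod, Finset.prod_mul_distrib, Finset.prod_pow_eq_pow_sum]
    rw [← Polynomial.C_mul_X_pow_eq_monomial, monomial_eq, ← mul_assoc]
    congr 1
    rw [map_mul, Finsupp.prod, map_prod]
    simp only [map_pow]
    rfl
  have hco : ∀ (f : MvPolynomial σ k) n, (φ f).coeff n = homogeneousComponent n f := by
    intro f n
    induction f using MvPolynomial.induction_on' with
    | monomial d r =>
      rw [hmon, Polynomial.coeff_monomial, homogeneousComponent_of_mem
        ((mem_homogeneousSubmodule _ _).2 (isHomogeneous_monomial (d := d) r rfl))]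
      simp only [eq_comm]
    | add p q hp hq => rw [map_add, Polynomial.coeff_add, hp, hq, map_add]
  have hinj : ∀ f, f ≠ 0 → φ f ≠ 0 := by
    intro f hf h0
    apply hf
    rw [← sum_homogeneousComponent f]
    apply Finset.sum_eq_zero
    intro i _
    rw [← hco, h0, Polynomial.coeff_zero]
  have hf : f ≠ 0 := left_ne_zero_of_mul hne
  have hh : h ≠ 0 := right_ne_zero_of_mul hne
  have hprod : φ f * φ h = Polynomial.monomial e (f * h) := by
    rw [← map_mul]
    ext1 n
    rw [hco, Polynomial.coeff_monomial, homogeneousComponent_of_mem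
        ((mem_homogeneousSubmodule _ _).2 hfh)]
    simp only [eq_comm]
  have h1 := Polynomial.natDegree_mul (hinj f hf) (hinj h hh)
  have h2 := Polynomial.natTrailingDegree_mul (hinj f hf) (hinj h hh)
  rw [hprod] at h1 h2
  rw [Polynomial.natDegree_monomial_eq _ hne] at h1
  rw [Polynomial.natTrailingDegree_monomial hne] at h2
  have h3 := (φ f).natTrailingDegree_le_natDegree
  have h4 := (φ h).natTrailingDegree_le_natDegree
  have gen : ∀ f : MvPolynomial σ k, f ≠ 0 → (φ f).natTrailingDegree = (φ f).natDegree →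
      f.IsHomogeneous (φ f).natDegree := by
    intro f hf heq
    have : f = homogeneousComponent (φ f).natDegree f := by
      conv_lhs => rw [← sum_homogeneousComponent f]
      have h5 : ∀ i, i ≠ (φ f).natDegree → homogeneousComponent i f = 0 := by
        intro i hi
        rw [← hco]
        rcases lt_or_gt_of_ne hi with hi | hi
        · exact Polynomial.coeff_eq_zero_of_lt_natTrailingDegree (heq ▸ hi)
        · exact Polynomial.coeff_eq_zero_of_natDegree_lt hi
      by_cases hmem : (φ f).natDegree ∈ Finset.range (f.totalDegree + 1)
      · exact Finset.sum_eq_single_of_mem _ hmem (fun i _ hi => h5 i hi)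
      · exfalso
        apply hf
        rw [← sum_homogeneousComponent f]
        apply Finset.sum_eq_zero
        intro i hi
        exact h5 i (fun h => hmem (h ▸ hi))
    have h7 := homogeneousComponent_isHomogeneous (φ f).natDegree f
    rwa [← this] at h7
  refine ⟨_, _, gen f hf (by omega), gen h hh (by omega), h1.symm⟩

open MvPolynomial in
/-- Linear forms. -/
noncomputable def auxLf {n : ℕ} {k : Type*} [Field k] : (Fin n → k) →ₗ[k] MvPolynomial (Fin n) k where
  toFun y := ∑ i, C (y i) * X i
  map_add' y z := by simp [add_mul, Finset.sum_add_distrib]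
  map_smul' c y := by simp [Finset.smul_sum, MvPolynomial.smul_eq_C_mul, mul_assoc]

open MvPolynomial in
theorem auxLf_apply {n : ℕ} {k : Type*} [Field k] (y : Fin n → k) :
    auxLf y = ∑ i, C (y i) * X i := rfl

open MvPolynomial in
theorem auxLf_hom {n : ℕ} {k : Type*} [Field k] (y : Fin n → k) :
    (auxLf y).IsHomogeneous 1 :=
  IsHomogeneous.sum _ _ _ (fun _ _ => isHomogeneous_C_mul_X _ _)

open MvPolynomial in
theorem auxLf_coeff {n : ℕ} {k : Type*} [Field k] (y : Fin n → k) (j : Fin n) :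
    coeff (Finsupp.single j 1) (auxLf y) = y j := by
  classical
  rw [auxLf_apply, coeff_sum]
  simp [coeff_C_mul, coeff_X, Finsupp.single_left_inj]

open MvPolynomial in
theorem auxLf_inj {n : ℕ} {k : Type*} [Field k] : Function.Injective (auxLf : (Fin n → k) →ₗ[k] _) := by
  intro y z h
  ext j
  rw [← auxLf_coeff y, h, auxLf_coeff]

open MvPolynomial in
theorem auxLf_eval {n : ℕ} {k : Type*} [Field k] (y a : Fin n → k) :
    eval a (auxLf y) = ∑ i, y i * a i := by
  simp [auxLf_apply]

open MvPolynomial in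
theorem aux_hom_zero {n : ℕ} {k : Type*} [Field k] {f : MvPolynomial (Fin n) k}
    (hf : f.IsHomogeneous 0) : ∃ c, f = C c :=
  ⟨_, totalDegree_eq_zero_iff_eq_C.1 (Nat.le_zero.1 hf.totalDegree_le)⟩

open MvPolynomial in
theorem aux_hom_eval0 {σ : Type*} {k : Type*} [Field k] {f : MvPolynomial σ k} {e : ℕ}
    (hf : f.IsHomogeneous e) (he : e ≠ 0) : eval 0 f = 0 := by
  have : eval (0 : σ → k) f = coeff 0 f := by
    rw [← constantCoeff_eq, ← aeval_eq_eval]; simp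
  rw [this]
  exact hf.coeff_eq_zero (by simpa using he.symm)

open MvPolynomial in
theorem aux_hom_one {n : ℕ} {k : Type*} [Field k] {f : MvPolynomial (Fin n) k}
    (hf : f.IsHomogeneous 1) : ∃ y, f = auxLf y := by
  have h := (mem_homogeneousSubmodule 1 f).2 hf
  rw [homogeneousSubmodule_one_eq_span_X] at h
  obtain ⟨c, hc⟩ := (Submodule.mem_span_range_iff_exists_fun k).1 h
  exact ⟨c, by rw [← hc, auxLf_apply]; simp [smul_eq_C_mul]⟩

open MvPolynomial in
theorem auxLf_prime {n : ℕ} {k : Type*} [Field k] {y : Fin n → k} (hy : y ≠ 0) :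
    Prime (auxLf y) := by
  have hne : auxLf y ≠ 0 := fun h => hy (auxLf_inj (by rw [h, map_zero]))
  rw [← irreducible_iff_prime]
  apply irreducible_of_totalDegree_eq_one ((auxLf_hom y).totalDegree hne)
  intro x hx
  obtain ⟨j, hj⟩ := Function.ne_iff.1 hy
  have := hx (Finsupp.single j 1)
  rw [auxLf_coeff] at this
  rw [isUnit_iff_ne_zero]
  rintro rfl
  exact hj (zero_dvd_iff.1 this)

open MvPolynomial in
/-- divisibility of a linear form by a nonzero homogeneous polynomial of positive degree -/
theorem auxLf_dvd {n : ℕ} {k : Type*} [Field k] {z y : Fin n → k} (h : auxLf z ∣ auxLf y) :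
    ∃ c : k, y = c • z := by
  by_cases hy : y = 0
  · exact ⟨0, by simp [hy]⟩
  have hne : auxLf y ≠ 0 := fun h => hy (auxLf_inj (by rw [h, map_zero]))
  obtain ⟨m, hm⟩ := h
  rw [hm] at hne
  obtain ⟨a, b, ha, hb, hab⟩ := aux_hom_factor (hm ▸ auxLf_hom y) hne
  have := ha.inj_right (auxLf_hom z) (left_ne_zero_of_mul hne)
  obtain ⟨c, rfl⟩ := aux_hom_zero (f := m) (by convert hb; omega)
  refine ⟨c, auxLf_inj ?_⟩
  rw [hm, map_smul, smul_eq_C_mul, mul_comm]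

open MvPolynomial in
theorem aux_two_term {n : ℕ} {k : Type*} [Field k] {y z : Fin n → k}
    (hyz : LinearIndependent k ![y, z]) {P Q : MvPolynomial (Fin n) k}
    (h : auxLf y * P + auxLf z * Q = 0) : ∃ m, P = auxLf z * m ∧ Q = - (auxLf y * m) := by
  have hz : z ≠ 0 := hyz.ne_zero 1
  have hz' : auxLf z ≠ 0 := (auxLf_prime hz).ne_zero
  have h1 : auxLf z ∣ auxLf y * P := ⟨-Q, by linear_combination h⟩
  rcases (auxLf_prime hz).dvd_or_dvd h1 with h2 | ⟨m, hm⟩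
  · exfalso
    obtain ⟨c, hc⟩ := auxLf_dvd h2
    have := (LinearIndependent.pair_iff.1 hyz) 1 (-c) (by rw [hc]; simp)
    exact one_ne_zero this.1
  · refine ⟨m, hm, ?_⟩
    apply mul_left_cancel₀ hz'
    rw [hm] at h
    linear_combination h

open MvPolynomial in
theorem aux_star {k : Type*} [Field k] [IsAlgClosed k] {H : Type*} [AddCommGroup H] [Module k H]
    (g : H →ₗ[k] MvPolynomial (Fin 4) k) (q : MvPolynomial (Fin 4) k) (hq0 : eval 0 q = 0)
    (nz : ∀ a, (∀ v, eval a (g v) = 0) → eval a q = 0 → a = 0)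
    (f1 f2 : MvPolynomial (Fin 4) k) (h1 : eval 0 f1 = 0) (h2 : eval 0 f2 = 0)
    (hs : ∀ v, g v ∈ Ideal.span {f1, f2}) : False := by
  classical
  obtain ⟨a, ha, hz⟩ := aux_common_zero ({f1, f2, q} : Finset (MvPolynomial (Fin 4) k)) (by
    intro f hf
    simp only [Finset.mem_insert, Finset.mem_singleton] at hf
    rcases hf with rfl | rfl | rfl <;> assumption)
    (lt_of_le_of_lt Finset.card_le_three (by norm_num))
  apply ha
  refine nz a (fun v => ?_) (hz q (by simp))
  obtain ⟨x, y, hxy⟩ := Ideal.mem_span_pair.1 (hs v)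
  rw [← hxy, map_add, map_mul, map_mul, hz f1 (by simp), hz f2 (by simp)]
  simp

theorem aux_rank2' {k : Type*} [Field k] {H : Type*} [AddCommGroup H] [Module k H]
    (l : Fin 4 → H) (h0 : l 0 = 0) (p : Fin 3 → k) (hp : p ≠ 0) (hl : ∑ j, p j • l j.succ = 0) :
    ∃ (A B : H) (y z : Fin 4 → k), LinearIndependent k ![y, z] ∧ ∀ i, l i = y i • A + z i • B := by
  obtain ⟨j0, hj0⟩ := Function.ne_iff.1 hp
  simp only [Fin.sum_univ_three] at hl
  have hl' : p 0 • l 1 + p 1 • l 2 + p 2 • l 3 = 0 := hl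
  fin_cases j0
  · have hj : p 0 ≠ 0 := hj0
    refine ⟨l 2, l 3, ![0, -p 1 / p 0, 1, 0], ![0, -p 2 / p 0, 0, 1], ?_, ?_⟩
    · rw [LinearIndependent.pair_iff]
      intro s t hst
      exact ⟨by simpa using congrFun hst 2, by simpa using congrFun hst 3⟩
    · have : l 1 = (-p 1 / p 0) • l 2 + (-p 2 / p 0) • l 3 := by
        have h3 := congrArg (fun w => (p 0)⁻¹ • w) hl'
        simp only [smul_add, smul_smul, smul_zero] at h3
        rw [inv_mul_cancel₀ hj, one_smul] at h3
        have := eq_neg_of_add_eq_zero_left (a := l 1) (by rw [← add_assoc]; exact h3)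
        rw [this, neg_add, ← neg_smul, ← neg_smul]
        congr 2 <;> field_simp
      intro i
      fin_cases i
      · simpa using h0
      · simpa using this
      · simp
      · simp
  · have hj : p 1 ≠ 0 := hj0
    refine ⟨l 1, l 3, ![0, 1, -p 0 / p 1, 0], ![0, 0, -p 2 / p 1, 1], ?_, ?_⟩
    · rw [LinearIndependent.pair_iff]
      intro s t hst
      exact ⟨by simpa using congrFun hst 1, by simpa using congrFun hst 3⟩
    · have : l 2 = (-p 0 / p 1) • l 1 + (-p 2 / p 1) • l 3 := by
        have h3 := congrArg (fun w => (p 1)⁻¹ • w) hl'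
        simp only [smul_add, smul_smul, smul_zero] at h3
        rw [inv_mul_cancel₀ hj, one_smul] at h3
        have := eq_neg_of_add_eq_zero_left (a := l 2)
          (b := ((p 1)⁻¹ * p 0) • l 1 + ((p 1)⁻¹ * p 2) • l 3) (by rw [← h3]; abel)
        rw [this, neg_add, ← neg_smul, ← neg_smul]
        congr 2 <;> field_simp
      intro i
      fin_cases i
      · simpa using h0
      · simp
      · simpa using this
      · simp
  · have hj : p 2 ≠ 0 := hj0
    refine ⟨l 1, l 2, ![0, 1, 0, -p 0 / p 2], ![0, 0, 1, -p 1 / p 2], ?_, ?_⟩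
    · rw [LinearIndependent.pair_iff]
      intro s t hst
      exact ⟨by simpa using congrFun hst 1, by simpa using congrFun hst 2⟩
    · have : l 3 = (-p 0 / p 2) • l 1 + (-p 1 / p 2) • l 2 := by
        have h3 := congrArg (fun w => (p 2)⁻¹ • w) hl'
        simp only [smul_add, smul_smul, smul_zero] at h3
        rw [inv_mul_cancel₀ hj, one_smul] at h3
        have := eq_neg_of_add_eq_zero_left (a := l 3)
          (b := ((p 2)⁻¹ * p 0) • l 1 + ((p 2)⁻¹ * p 1) • l 2) (by rw [← h3]; abel)
        rw [this, neg_add, ← neg_smul, ← neg_smul]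
        congr 2 <;> field_simp
      intro i
      fin_cases i
      · simpa using h0
      · simp
      · simp
      · simpa using this

theorem aux_rank2 {k : Type*} [Field k] {H : Type*} [AddCommGroup H] [Module k H]
    (l : Fin 4 → H) (h0 : l 0 = 0) (p : Fin 3 → k) (hp : p ≠ 0) (hl : ∑ j, p j • l j.succ = 0) :
    (∃ (A : H) (y : Fin 4 → k), ∀ i, l i = y i • A) ∨
    ∃ (A B : H) (y z : Fin 4 → k), LinearIndependent k ![A, B] ∧
      LinearIndependent k ![y, z] ∧ ∀ i, l i = y i • A + z i • B := by
  obtain ⟨A, B, y, z, hyz, h⟩ := aux_rank2' l h0 p hp hl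
  by_cases hAB : LinearIndependent k ![A, B]
  · exact Or.inr ⟨A, B, y, z, hAB, hyz, h⟩
  left
  by_cases hA : A = 0
  · exact ⟨B, z, fun i => by rw [h, hA]; simp⟩
  rw [LinearIndependent.pair_iff' hA] at hAB
  push Not at hAB
  obtain ⟨c, hc⟩ := hAB
  exact ⟨A, fun i => y i + z i * c, fun i => by rw [h, ← hc, add_smul, mul_smul]⟩

open MvPolynomial in
theorem aux_syz {k : Type*} [Field k] {H : Type*} [AddCommGroup H] [Module k H] {τ : Type*} [Fintype τ]
    (g : H →ₗ[k] MvPolynomial (Fin 4) k) (l : Fin 4 → H) (A : τ → H) (y : τ → Fin 4 → k)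
    (h : ∀ i, l i = ∑ t, y t i • A t) :
    ∑ i, X i * g (l i) = ∑ t, auxLf (y t) * g (A t) := by
  simp only [h, map_sum, map_smul, auxLf_apply, Finset.sum_mul, Finset.mul_sum]
  rw [Finset.sum_comm]
  refine Finset.sum_congr rfl fun t _ => Finset.sum_congr rfl fun i _ => ?_
  rw [smul_eq_C_mul]; ring

open MvPolynomial in
/-- The case in which `g` has a kernel: two syzygies suffice. -/
theorem aux_caseA {k : Type*} [Field k] [IsAlgClosed k] {H : Type*} [AddCommGroup H] [Module k H]
    [FiniteDimensional k H] (hH : Module.finrank k H = 3)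
    (g : H →ₗ[k] MvPolynomial (Fin 4) k) (q : MvPolynomial (Fin 4) k) {e : ℕ} (he : 2 ≤ e)
    (hg : ∀ v, (g v).IsHomogeneous e) (hq : q.IsHomogeneous e)
    (nz : ∀ a, (∀ v, eval a (g v) = 0) → eval a q = 0 → a = 0)
    (l1 l2 : Fin 4 → H) (h10 : l1 0 = 0) (h20 : l2 0 = 0)
    (s1 : ∑ i, X i * g (l1 i) = 0) (s2 : ∑ i, X i * g (l2 i) = 0)
    (s : Fin 4 → k) (hind : LinearIndependent k ![∑ i, s i • l1 i, ∑ i, s i • l2 i]) : False := by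
  have hg0 : ∀ v, eval 0 (g v) = 0 := fun v => aux_hom_eval0 (hg v) (by omega)
  have hq0 : eval 0 q = 0 := aux_hom_eval0 hq (by omega)
  -- a singular member of the pencil
  obtain ⟨α, β, hαβ, p, hp, hsing⟩ : ∃ α β : k, (α ≠ 0 ∨ β ≠ 0) ∧ ∃ p : Fin 3 → k, p ≠ 0 ∧
      ∑ j : Fin 3, p j • (α • l1 j.succ + β • l2 j.succ) = 0 := by
    let N1 : (Fin 3 → k) →ₗ[k] H := Fintype.linearCombination k (fun j => l1 j.succ)
    let N2 : (Fin 3 → k) →ₗ[k] H := Fintype.linearCombination k (fun j => l2 j.succ)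
    by_cases hN : Function.Injective N2
    · let E := LinearEquiv.ofInjectiveOfFinrankEq N2 hN (by simp [hH])
      obtain ⟨μ, hμ⟩ := Module.End.exists_eigenvalue ((E.symm : H →ₗ[k] _).comp N1)
      obtain ⟨p, hp⟩ := hμ.exists_hasEigenvector
      refine ⟨1, -μ, Or.inl one_ne_zero, p, hp.2, ?_⟩
      have h1 : E.symm (N1 p) = μ • p := hp.apply_eq_smul
      have h2 : N1 p = μ • N2 p := by
        have := congrArg E h1
        rw [LinearEquiv.apply_symm_apply, map_smul] at this
        exact this
      simp only [N1, N2, Fintype.linearCombination_apply] at h2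
      have h3 : ∑ j : Fin 3, p j • ((1 : k) • l1 j.succ + (-μ) • l2 j.succ) =
          ∑ j : Fin 3, p j • l1 j.succ - μ • ∑ j : Fin 3, p j • l2 j.succ := by
        rw [Finset.smul_sum, ← Finset.sum_sub_distrib]
        refine Finset.sum_congr rfl fun j _ => ?_
        rw [one_smul, smul_add, neg_smul, smul_neg, smul_comm, sub_eq_add_neg]
      rw [h3, h2, sub_self]
    · rw [← LinearMap.ker_eq_bot, Submodule.eq_bot_iff] at hN
      push Not at hN
      obtain ⟨p, hp, hp0⟩ := hN
      refine ⟨0, 1, Or.inr one_ne_zero, p, hp0, ?_⟩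
      simpa [N2, Fintype.linearCombination_apply] using hp
  set l : Fin 4 → H := fun i => α • l1 i + β • l2 i with hldef
  have hl0 : l 0 = 0 := by simp [l, h10, h20]
  have hsyz : ∑ i, X i * g (l i) = 0 := by
    have : ∑ i, X i * g (l i) = C α * ∑ i, X i * g (l1 i) + C β * ∑ i, X i * g (l2 i) := by
      simp only [l, map_add, map_smul, Finset.mul_sum, ← Finset.sum_add_distrib, smul_eq_C_mul]
      exact Finset.sum_congr rfl fun i _ => by ring
    rw [this, s1, s2]; simp
  have hls : ∑ i, s i • l i ≠ 0 := by
    intro h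
    have : α • (∑ i, s i • l1 i) + β • (∑ i, s i • l2 i) = 0 := by
      rw [← h]
      simp only [l, Finset.smul_sum, ← Finset.sum_add_distrib, smul_add, smul_smul, mul_comm]
    have := LinearIndependent.pair_iff.1 hind _ _ this
    tauto
  have hlne : ∃ i, l i ≠ 0 := by
    by_contra hcon
    push Not at hcon
    exact hls (by simp [hcon])
  obtain ⟨i0, hi0⟩ := hlne
  rcases aux_rank2 l hl0 p hp hsing with ⟨A, y, hA⟩ | ⟨A, B, y, z, hAB, hyz, hl⟩
  · have hA0 : A ≠ 0 := by rintro rfl; exact hi0 (by simp [hA])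
    have hy0 : y ≠ 0 := by rintro rfl; exact hi0 (by simp [hA])
    have hgA : g A = 0 := by
      have := aux_syz g l (fun _ : Fin 1 => A) (fun _ => y) (by simpa using hA)
      rw [hsyz] at this
      simp only [Finset.univ_unique, Finset.sum_const, Finset.card_singleton, one_smul] at this
      exact (mul_eq_zero.1 this.symm).resolve_left (auxLf_prime hy0).ne_zero
    obtain ⟨D, hD⟩ := exists_linearIndependent_pair_of_one_lt_finrank (R := k) (by rw [hH]; norm_num) hA0
    obtain ⟨E, hE⟩ := exists_linearIndependent_cons_of_lt_finrank hD (by rw [hH]; norm_num)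
    let b := basisOfLinearIndependentOfCardEqFinrank hE (by simp [hH])
    refine aux_star g q hq0 nz (g E) (g D) (hg0 _) (hg0 _) (fun v => ?_)
    rw [← b.sum_repr v]
    simp only [map_sum, map_smul, smul_eq_C_mul]
    refine Ideal.sum_mem _ fun i _ => Ideal.mul_mem_left _ _ ?_
    fin_cases i
    · simpa [b] using Ideal.subset_span (by simp)
    · simp [b, hgA]
    · simpa [b] using Ideal.subset_span (by simp)
  · have := aux_syz g l ![A, B] ![y, z] (by simpa using hl)
    rw [hsyz] at this
    simp only [Fin.sum_univ_two, Matrix.cons_val_zero, Matrix.cons_val_one] at this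
    obtain ⟨m, hm1, hm2⟩ := aux_two_term hyz this.symm
    have hm0 : eval 0 m = 0 := by
      by_cases hm : m = 0
      · simp [hm]
      have hz0 : auxLf z ≠ 0 := (auxLf_prime (hyz.ne_zero 1)).ne_zero
      obtain ⟨a, b, ha, hb, hab⟩ := aux_hom_factor (hm1 ▸ hg A) (mul_ne_zero hz0 hm)
      have := ha.inj_right (auxLf_hom z) hz0
      exact aux_hom_eval0 hb (by omega)
    obtain ⟨E, hE⟩ := exists_linearIndependent_cons_of_lt_finrank hAB (by rw [hH]; norm_num)
    let b := basisOfLinearIndependentOfCardEqFinrank hE (by simp [hH])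
    refine aux_star g q hq0 nz (g E) m (hg0 _) hm0 (fun v => ?_)
    rw [← b.sum_repr v]
    simp only [map_sum, map_smul, smul_eq_C_mul]
    refine Ideal.sum_mem _ fun i _ => Ideal.mul_mem_left _ _ ?_
    have hmem : m ∈ Ideal.span {g E, m} := Ideal.subset_span (by simp)
    fin_cases i
    · simpa [b] using Ideal.subset_span (by simp)
    · simpa [b, hm1] using Ideal.mul_mem_left _ _ hmem
    · simpa [b, hm2] using Ideal.mul_mem_left _ _ hmem

open MvPolynomial in
theorem aux_plane {k : Type*} [Field k] [IsAlgClosed k]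
    (P Q q : MvPolynomial (Fin 4) k) (hP : P.IsHomogeneous 2) (hQ : Q.IsHomogeneous 2)
    (hq : q.IsHomogeneous 2) (μ : Fin 4 → k) (hμ : μ ≠ 0)
    (nz : ∀ a, eval a (auxLf μ) = 0 → eval a P = 0 → eval a Q = 0 → eval a q = 0 → a = 0)
    (a b : Fin 4 → k) (r : MvPolynomial (Fin 4) k)
    (hr : auxLf a * P + auxLf b * Q = auxLf μ * r) : ∃ α β : k, a = α • μ ∧ b = β • μ := by
  classical
  obtain ⟨j0, hj0⟩ := Function.ne_iff.1 hμ
  simp only [Pi.zero_apply] at hj0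
  let ν : Fin 3 → k := fun j => - μ (j0.succAbove j) / μ j0
  let im : Fin 4 → MvPolynomial (Fin 3) k := j0.insertNth (auxLf ν) (fun j => X j)
  let θ : MvPolynomial (Fin 4) k →ₐ[k] MvPolynomial (Fin 3) k := aeval im
  have him : ∀ i, (im i).IsHomogeneous 1 := by
    intro i
    induction i using Fin.succAboveCases j0 with
    | x => simpa [im] using auxLf_hom ν
    | p i => simpa [im] using isHomogeneous_X k i
  have hθhom : ∀ f : MvPolynomial (Fin 4) k, f.IsHomogeneous 2 → (θ f).IsHomogeneous 2 := by
    intro f hf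
    have := hf.aeval im (n := 1) him
    exact this
  have hθl : ∀ a : Fin 4 → k, θ (auxLf a) = auxLf (a j0 • ν + fun j => a (j0.succAbove j)) := by
    intro a
    rw [auxLf_apply, Fin.sum_univ_succAbove _ j0, map_add, map_sum, map_add auxLf, map_smul, smul_eq_C_mul]
    simp only [map_mul, θ, aeval_X, algHom_C, im, Fin.insertNth_apply_same, Fin.insertNth_apply_succAbove]
    rfl
  have hθm : θ (auxLf μ) = 0 := by
    rw [hθl]
    have h0 : (μ j0 • ν + fun j => μ (j0.succAbove j)) = 0 := ?_
    · rw [h0, map_zero]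
    ext j
    simp only [ν, Pi.add_apply, Pi.smul_apply, smul_eq_mul, Pi.zero_apply]
    field_simp
    ring
  have hker : ∀ a : Fin 4 → k, θ (auxLf a) = 0 → ∃ α : k, a = α • μ := by
    intro a ha
    rw [hθl] at ha
    have h1 := auxLf_inj (ha.trans (map_zero _).symm)
    refine ⟨a j0 / μ j0, ?_⟩
    ext i
    induction i using Fin.succAboveCases j0 with
    | x => simp [hj0]
    | p i =>
      have := congrFun h1 i
      simp only [ν, Pi.add_apply, Pi.smul_apply, smul_eq_mul, Pi.zero_apply] at this
      simp only [Pi.smul_apply, smul_eq_mul]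
      field_simp at this ⊢
      linear_combination this
  have hev : ∀ (v : Fin 3 → k) f, eval v (θ f) = eval (j0.insertNth (eval v (auxLf ν)) v) f := by
    intro v f
    have : (aeval v).comp θ = aeval (j0.insertNth (eval v (auxLf ν)) v : Fin 4 → k) := by
      apply MvPolynomial.algHom_ext
      intro i
      induction i using Fin.succAboveCases j0 with
      | x => simp [θ, im, aeval_eq_eval]
      | p i => simp [θ, im]
    have := DFunLike.congr_fun this f
    simpa [aeval_eq_eval] using this
  have nz' : ∀ v : Fin 3 → k, eval v (θ P) = 0 → eval v (θ Q) = 0 → eval v (θ q) = 0 → v = 0 := by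
    intro v h1 h2 h3
    have := nz (j0.insertNth (eval v (auxLf ν)) v) (by rw [← hev, hθm, map_zero])
      (by rw [← hev, h1]) (by rw [← hev, h2]) (by rw [← hev, h3])
    ext i
    have h4 := congrFun this (j0.succAbove i)
    simpa using h4
  have two : ∀ f : MvPolynomial (Fin 3) k, eval 0 f = 0 → f ∣ θ P → f ∣ θ Q → False := by
    intro f hf ⟨p, hp⟩ ⟨s, hs⟩
    obtain ⟨v, hv, hvz⟩ := aux_common_zero ({f, θ q} : Finset (MvPolynomial (Fin 3) k)) (by
      intro h hh
      simp only [Finset.mem_insert, Finset.mem_singleton] at hh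
      rcases hh with rfl | rfl
      · exact hf
      · exact aux_hom_eval0 (hθhom _ hq) (by norm_num))
      (lt_of_le_of_lt Finset.card_le_two (by norm_num))
    apply hv
    have hfv := hvz f (by simp)
    exact nz' v (by rw [hp, map_mul, hfv, zero_mul]) (by rw [hs, map_mul, hfv, zero_mul])
      (hvz _ (by simp))
  have hP0 : θ P ≠ 0 := by
    intro h
    refine two (θ Q) (aux_hom_eval0 (hθhom _ hQ) (by norm_num)) (by simp [h]) dvd_rfl
  have hrel : θ (auxLf a) * θ P + θ (auxLf b) * θ Q = 0 := by
    have := congrArg θ hr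
    simpa [hθm] using this
  have hdvd : θ P ∣ θ (auxLf b) := by
    refine UniqueFactorizationMonoid.dvd_of_dvd_mul_left_of_no_prime_factors (c := θ Q) hP0 ?_
      ⟨- θ (auxLf a), by linear_combination hrel⟩
    intro d hd1 hd2 hdp
    refine two d ?_ hd1 hd2
    obtain ⟨w, hw⟩ := hd1
    obtain ⟨x, y, hx, hy, hxy⟩ := aux_hom_factor (hw ▸ hθhom _ hP) (hw ▸ hP0)
    refine aux_hom_eval0 hx ?_
    rintro rfl
    obtain ⟨c, rfl⟩ := aux_hom_zero hx
    have hc : c ≠ 0 := by rintro rfl; exact hdp.ne_zero (map_zero _)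
    exact hdp.not_isUnit ((isUnit_iff_ne_zero.2 hc).map C)
  have hb : θ (auxLf b) = 0 := by
    by_contra hb
    obtain ⟨w, hw⟩ := hdvd
    have h1 : (θ (auxLf b)).IsHomogeneous 1 := by rw [hθl]; exact auxLf_hom _
    obtain ⟨x, y, hx, hy, hxy⟩ := aux_hom_factor (hw ▸ h1) (hw ▸ hb)
    have := hx.inj_right (hθhom _ hP) hP0
    omega
  have ha : θ (auxLf a) = 0 := by
    rw [hb, zero_mul, add_zero] at hrel
    exact (mul_eq_zero.1 hrel).resolve_right hP0
  obtain ⟨α, hα⟩ := hker a ha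
  obtain ⟨β, hβ⟩ := hker b hb
  exact ⟨α, β, hα, hβ⟩

theorem aux_ufd {R : Type*} [CommRing R] [IsDomain R] [UniqueFactorizationMonoid R] {m D a b : R}
    (hm : m ≠ 0) (h : ∀ p, Prime p → p ∣ m → p ∣ a → p ∣ b → False) (ha : m ∣ D * a) (hb : m ∣ D * b) :
    m ∣ D := by
  classical
  let : GCDMonoid R := UniqueFactorizationMonoid.toGCDMonoid R
  have h1 : m ∣ gcd (D * a) (D * b) := dvd_gcd ha hb
  have h2 : m ∣ D * gcd a b := h1.trans (gcd_mul_left' D a b).dvd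
  refine UniqueFactorizationMonoid.dvd_of_dvd_mul_left_of_no_prime_factors hm ?_ h2
  intro d hd1 hd2 hdp
  exact h d hdp hd1 (hd2.trans (gcd_dvd_left _ _)) (hd2.trans (gcd_dvd_right _ _))

open MvPolynomial in
theorem aux_caseB {k : Type*} [Field k] [IsAlgClosed k] {H : Type*} [AddCommGroup H] [Module k H]
    (g : H →ₗ[k] MvPolynomial (Fin 4) k) (q : MvPolynomial (Fin 4) k) {e : ℕ} (he : e = 2 ∨ e = 3)
    (hg : ∀ v, (g v).IsHomogeneous e) (hq : q.IsHomogeneous e)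
    (nz : ∀ a, (∀ v, eval a (g v) = 0) → eval a q = 0 → a = 0)
    {M : Type*} [AddCommGroup M] [Module k M]
    (ℓ : M →ₗ[k] (Fin 4 → H)) (hsyz : ∀ c, ∑ i, X i * g (ℓ c i) = 0)
    (hℓ : Function.Injective ℓ)
    (b : Module.Basis (Fin 4) k H) (y z : Fin 4 → k) (hyz : LinearIndependent k ![y, z])
    (m : MvPolynomial (Fin 4) k) (hm : m ≠ 0) (hA : g (b 2) = auxLf z * m)
    (hB : g (b 3) = - (auxLf y * m)) (u : M) (hu : ∀ i, ℓ u i = y i • b 2 + z i • b 3)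
    (c' c'' : M) (hli : ∀ α β κ : k, α • c' + β • c'' = κ • u → α = 0 ∧ β = 0) : False := by
  have he2 : 2 ≤ e := by omega
  have hg0 : ∀ v, eval 0 (g v) = 0 := fun v => aux_hom_eval0 (hg v) (by omega)
  have hq0 : eval 0 q = 0 := aux_hom_eval0 hq (by omega)
  have hy0 : auxLf y ≠ 0 := (auxLf_prime (hyz.ne_zero 0)).ne_zero
  have hz0 : auxLf z ≠ 0 := (auxLf_prime (hyz.ne_zero 1)).ne_zero
  let lam : Fin 4 → M →ₗ[k] (Fin 4 → k) := fun t => (LinearMap.compLeft (b.coord t) (Fin 4)) ∘ₗ ℓ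
  have hlam : ∀ c i, ℓ c i = ∑ t, lam t c i • b t := by
    intro c i
    exact (b.sum_repr (ℓ c i)).symm
  set Y := auxLf y with hY
  set Z := auxLf z with hZ
  have hrel : ∀ c, auxLf (lam 0 c) * g (b 0) + auxLf (lam 1 c) * g (b 1) =
      m * (Y * auxLf (lam 3 c) - Z * auxLf (lam 2 c)) := by
    intro c
    have h1 := aux_syz g (ℓ c) b (fun t => lam t c) (hlam c)
    rw [hsyz, Fin.sum_univ_four, hA, hB] at h1
    linear_combination -h1
  have hmhom : m.IsHomogeneous (e - 1) := by
    obtain ⟨a, b, ha, hb, hab⟩ := aux_hom_factor (hA ▸ hg (b 2)) (mul_ne_zero hz0 hm)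
    have := ha.inj_right (auxLf_hom z) hz0
    rwa [show e - 1 = b by omega]
  have hpi : ∀ p, Prime p → p ∣ m → eval 0 p = 0 := by
    rintro p hp ⟨w, hw⟩
    obtain ⟨x, y, hx, hy, hxy⟩ := aux_hom_factor (hw ▸ hmhom) (hw ▸ hm)
    refine aux_hom_eval0 hx ?_
    rintro rfl
    obtain ⟨c, rfl⟩ := aux_hom_zero hx
    have hc : c ≠ 0 := by rintro rfl; exact hp.ne_zero (map_zero _)
    exact hp.not_isUnit ((isUnit_iff_ne_zero.2 hc).map C)
  have star : ∀ f1 f2, eval 0 f1 = 0 → eval 0 f2 = 0 → (∀ t, g (b t) ∈ Ideal.span {f1, f2}) → False := by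
    intro f1 f2 h1 h2 h
    refine aux_star g q hq0 nz f1 f2 h1 h2 (fun v => ?_)
    rw [← b.sum_repr v]
    simp only [map_sum, map_smul, smul_eq_C_mul]
    exact Ideal.sum_mem _ fun i _ => Ideal.mul_mem_left _ _ (h i)
  have ncp : ∀ p f, Prime p → p ∣ m → eval 0 f = 0 → g (b 0) ∈ Ideal.span {p, f} →
      g (b 1) ∈ Ideal.span {p, f} → False := by
    intro p f hp hpm hf h0 h1
    have hmm : m ∈ Ideal.span {p, f} := by
      obtain ⟨w, hw⟩ := hpm
      rw [hw]
      exact Ideal.mul_mem_right _ _ (Ideal.subset_span (by simp))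
    refine star p f (hpi p hp hpm) hf ?_
    intro t
    fin_cases t
    · exact h0
    · exact h1
    · change g (b 2) ∈ _
      rw [hA]; exact Ideal.mul_mem_left _ _ hmm
    · change g (b 3) ∈ _
      rw [hB]; exact neg_mem (Ideal.mul_mem_left _ _ hmm)
  have hYm : Y ∈ Ideal.span {Y, Z} := Ideal.subset_span (by simp)
  have hZm : Z ∈ Ideal.span {Y, Z} := Ideal.subset_span (by simp)
  have hr : ∀ c, Y * auxLf (lam 3 c) - Z * auxLf (lam 2 c) ∈ Ideal.span {Y, Z} := fun c =>
    sub_mem (Ideal.mul_mem_right _ _ hYm) (Ideal.mul_mem_right _ _ hZm)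
  have fin : ∀ δ : k, δ ≠ 0 → C δ * g (b 0) ∈ Ideal.span {Y, Z} → C δ * g (b 1) ∈ Ideal.span {Y, Z} →
      False := by
    intro δ hδ h0 h1
    have inv : ∀ f, C δ * f ∈ Ideal.span {Y, Z} → f ∈ Ideal.span {Y, Z} := by
      intro f hf
      have := Ideal.mul_mem_left _ (C δ⁻¹) hf
      rwa [← mul_assoc, ← map_mul, inv_mul_cancel₀ hδ, map_one, one_mul] at this
    refine star Y Z (aux_hom_eval0 (auxLf_hom y) one_ne_zero) (aux_hom_eval0 (auxLf_hom z) one_ne_zero) ?_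
    intro t
    fin_cases t
    · exact inv _ h0
    · exact inv _ h1
    · change g (b 2) ∈ _
      rw [hA]; exact Ideal.mul_mem_right _ _ hZm
    · change g (b 3) ∈ _
      rw [hB]; exact neg_mem (Ideal.mul_mem_right _ _ hYm)
  have row : ∀ c, lam 0 c = 0 → lam 1 c = 0 → ∃ κ : k, c = κ • u := by
    intro c h0 h1
    have h2 := hrel c
    rw [h0, h1, map_zero, zero_mul, zero_mul, add_zero] at h2
    have h3 := (mul_eq_zero.1 h2.symm).resolve_left hm
    obtain ⟨n, hn1, hn2⟩ := aux_two_term hyz (P := auxLf (lam 3 c)) (Q := - auxLf (lam 2 c))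
      (by linear_combination h3)
    have hn2' : auxLf (lam 2 c) = auxLf y * n := by linear_combination -hn2
    obtain ⟨κ, hκ⟩ := auxLf_dvd ⟨n, hn1⟩
    obtain ⟨κ', hκ'⟩ := auxLf_dvd ⟨n, hn2'⟩
    have e1 : C κ = n := by
      apply mul_left_cancel₀ hz0
      rw [← hn1, hκ, map_smul, smul_eq_C_mul, mul_comm]
    have e2 : C κ' = n := by
      apply mul_left_cancel₀ hy0
      rw [← hn2', hκ', map_smul, smul_eq_C_mul, mul_comm]
    have e3 : κ' = κ := C_injective _ _ (e2.trans e1.symm)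
    refine ⟨κ, hℓ ?_⟩
    rw [map_smul]
    funext i
    rw [hlam, Fin.sum_univ_four, h0, h1, hκ, hκ', e3, Pi.smul_apply (f := ℓ u), hu]
    simp [mul_smul]
  rcases he with rfl | rfl
  · -- `e = 2`
    obtain ⟨μ, hμ⟩ := aux_hom_one hmhom
    have hμ0 : μ ≠ 0 := by rintro rfl; exact hm (by rw [hμ, map_zero])
    have hpl : ∀ c, ∃ α β : k, lam 0 c = α • μ ∧ lam 1 c = β • μ := by
      intro c
      refine aux_plane (g (b 0)) (g (b 1)) q (hg _) (hg _) hq μ hμ0 ?_ _ _ _ (hμ ▸ hrel c)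
      intro a h1 h2 h3 h4
      refine nz a (fun v => ?_) h4
      rw [← hμ] at h1
      rw [← b.sum_repr v]
      simp only [map_sum, map_smul, smul_eq_C_mul, map_mul]
      apply Finset.sum_eq_zero
      intro t _
      fin_cases t
      · change _ * eval a (g (b 0)) = 0
        rw [h2, mul_zero]
      · change _ * eval a (g (b 1)) = 0
        rw [h3, mul_zero]
      · change _ * eval a (g (b 2)) = 0
        rw [hA, map_mul, h1]; simp
      · change _ * eval a (g (b 3)) = 0
        rw [hB, map_neg, map_mul, h1]; simp
    obtain ⟨α, β, h0, h1⟩ := hpl c'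
    obtain ⟨α', β', h0', h1'⟩ := hpl c''
    by_cases hδ : α * β' - β * α' = 0
    · obtain ⟨κ, hκ⟩ := row (β' • c' + (-β) • c'')
        (by rw [map_add, map_smul, map_smul, h0, h0', smul_smul, smul_smul, ← add_smul]
            rw [show β' * α + -β * α' = 0 by linear_combination hδ, zero_smul])
        (by rw [map_add, map_smul, map_smul, h1, h1', smul_smul, smul_smul, ← add_smul]
            rw [show β' * β + -β * β' = 0 by ring, zero_smul])
      obtain ⟨e1, e2⟩ := hli _ _ _ hκ
      obtain ⟨κ, hκ⟩ := row (α' • c' + (-α) • c'')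
        (by rw [map_add, map_smul, map_smul, h0, h0', smul_smul, smul_smul, ← add_smul]
            rw [show α' * α + -α * α' = 0 by ring, zero_smul])
        (by rw [map_add, map_smul, map_smul, h1, h1', smul_smul, smul_smul, ← add_smul]
            rw [show α' * β + -α * β' = 0 by linear_combination -hδ, zero_smul])
      obtain ⟨e3, e4⟩ := hli _ _ _ hκ
      obtain ⟨κ, hκ⟩ := row c' (by rw [h0, neg_eq_zero.1 e4, zero_smul])
        (by rw [h1, neg_eq_zero.1 e2, zero_smul])
      have := hli 1 0 κ (by rw [hκ]; simp)
      exact one_ne_zero this.1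
    · have r1 := hrel c'
      have r2 := hrel c''
      rw [h0, h1, map_smul, map_smul, ← hμ, smul_eq_C_mul, smul_eq_C_mul] at r1
      rw [h0', h1', map_smul, map_smul, ← hμ, smul_eq_C_mul, smul_eq_C_mul] at r2
      have q1 := mul_left_cancel₀ hm (a := m) (b := C α * g (b 0) + C β * g (b 1))
        (by rw [← r1]; ring)
      have q2 := mul_left_cancel₀ hm (a := m) (b := C α' * g (b 0) + C β' * g (b 1))
        (by rw [← r2]; ring)
      refine fin _ hδ ?_ ?_
      · have : C (α * β' - β * α') * g (b 0) = C β' * (C α * g (b 0) + C β * g (b 1)) -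
          C β * (C α' * g (b 0) + C β' * g (b 1)) := by
          simp only [map_sub, map_mul]; ring
        rw [this, q1, q2]
        exact sub_mem (Ideal.mul_mem_left _ _ (hr _)) (Ideal.mul_mem_left _ _ (hr _))
      · have : C (α * β' - β * α') * g (b 1) = C α * (C α' * g (b 0) + C β' * g (b 1)) -
          C α' * (C α * g (b 0) + C β * g (b 1)) := by
          simp only [map_sub, map_mul]; ring
        rw [this, q1, q2]
        exact sub_mem (Ideal.mul_mem_left _ _ (hr _)) (Ideal.mul_mem_left _ _ (hr _))
  · -- `e = 3`
    have hmhom : m.IsHomogeneous 2 := hmhom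
    have hdv : ∀ v, m ∣ auxLf v → v = 0 := by
      rintro v ⟨w, hw⟩
      by_contra hv
      have hne : auxLf v ≠ 0 := (auxLf_prime hv).ne_zero
      obtain ⟨x, y, hx, hy, hxy⟩ := aux_hom_factor (hw ▸ auxLf_hom v) (hw ▸ hne)
      have := hx.inj_right hmhom hm
      omega
    have col1 : ∀ c (κ : k), lam 0 c = κ • lam 1 c → lam 1 c = 0 := by
      intro c κ h
      apply hdv
      refine UniqueFactorizationMonoid.dvd_of_dvd_mul_left_of_no_prime_factors
        (c := C κ * g (b 0) + g (b 1)) hm ?_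
        ⟨Y * auxLf (lam 3 c) - Z * auxLf (lam 2 c), ?_⟩
      rotate_right
      · rw [← hrel c, h, map_smul, smul_eq_C_mul]; ring
      intro d hd1 hd2 hdp
      have hd : C κ * g (b 0) + g (b 1) ∈ Ideal.span {d, g (b 0)} := by
        obtain ⟨w, hw⟩ := hd2
        rw [hw]
        exact Ideal.mul_mem_right _ _ (Ideal.subset_span (by simp))
      have h0 : g (b 0) ∈ Ideal.span {d, g (b 0)} := Ideal.subset_span (by simp)
      refine ncp d (g (b 0)) hdp hd1 (hg0 _) h0 ?_
      have := sub_mem hd (Ideal.mul_mem_left _ (C κ) h0)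
      rwa [add_sub_cancel_left] at this
    have col2 : ∀ c (κ : k), lam 1 c = κ • lam 0 c → lam 0 c = 0 := by
      intro c κ h
      apply hdv
      refine UniqueFactorizationMonoid.dvd_of_dvd_mul_left_of_no_prime_factors
        (c := g (b 0) + C κ * g (b 1)) hm ?_
        ⟨Y * auxLf (lam 3 c) - Z * auxLf (lam 2 c), ?_⟩
      rotate_right
      · rw [← hrel c, h, map_smul, smul_eq_C_mul]; ring
      intro d hd1 hd2 hdp
      have hd : g (b 0) + C κ * g (b 1) ∈ Ideal.span {d, g (b 1)} := by
        obtain ⟨w, hw⟩ := hd2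
        rw [hw]
        exact Ideal.mul_mem_right _ _ (Ideal.subset_span (by simp))
      have h0 : g (b 1) ∈ Ideal.span {d, g (b 1)} := Ideal.subset_span (by simp)
      refine ncp d (g (b 1)) hdp hd1 (hg0 _) ?_ h0
      have := sub_mem hd (Ideal.mul_mem_left _ (C κ) h0)
      rwa [add_sub_cancel_right] at this
    have r1 := hrel c'
    have r2 := hrel c''
    set R' := Y * auxLf (lam 3 c') - Z * auxLf (lam 2 c')
    set R'' := Y * auxLf (lam 3 c'') - Z * auxLf (lam 2 c'')
    set D := auxLf (lam 0 c') * auxLf (lam 1 c'') - auxLf (lam 1 c') * auxLf (lam 0 c'') with hD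
    by_cases hD0 : D = 0
    · have h0 : lam 0 c' ≠ 0 := by
        intro h0
        have h1 := col1 c' 0 (by rw [h0, zero_smul])
        obtain ⟨κ, hκ⟩ := row c' h0 h1
        have := hli 1 0 κ (by rw [hκ]; simp)
        exact one_ne_zero this.1
      have hdvd : auxLf (lam 0 c') ∣ auxLf (lam 1 c') * auxLf (lam 0 c'') :=
        ⟨auxLf (lam 1 c''), by linear_combination hD - hD0⟩
      rcases (auxLf_prime h0).dvd_or_dvd hdvd with h | h
      · obtain ⟨κ, hκ⟩ := auxLf_dvd h
        exact h0 (col2 c' κ hκ)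
      · obtain ⟨κ, hκ⟩ := auxLf_dvd h
        have h1 : lam 1 c'' = κ • lam 1 c' := by
          apply auxLf_inj
          apply mul_left_cancel₀ (auxLf_prime h0).ne_zero
          rw [map_smul, smul_eq_C_mul]
          rw [hκ, map_smul, smul_eq_C_mul] at hD
          linear_combination hD0 - hD
        obtain ⟨κ', hκ'⟩ := row ((-κ) • c' + (1 : k) • c'')
          (by rw [map_add, map_smul, map_smul, hκ]; simp)
          (by rw [map_add, map_smul, map_smul, h1]; simp)
        exact one_ne_zero (hli _ _ _ hκ').2
    · have g0 : D * g (b 0) = m * (R' * auxLf (lam 1 c'') - R'' * auxLf (lam 1 c')) := by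
        linear_combination auxLf (lam 1 c'') * r1 - auxLf (lam 1 c') * r2
      have g1 : D * g (b 1) = m * (auxLf (lam 0 c') * R'' - auxLf (lam 0 c'') * R') := by
        linear_combination auxLf (lam 0 c') * r2 - auxLf (lam 0 c'') * r1
      have hmD : m ∣ D := by
        refine aux_ufd hm ?_ ⟨_, g0⟩ ⟨_, g1⟩
        intro p hp hpm h0 h1
        refine ncp p 0 hp hpm (map_zero _) ?_ ?_
        · obtain ⟨w, hw⟩ := h0
          rw [hw]
          exact Ideal.mul_mem_right _ _ (Ideal.subset_span (by simp))
        · obtain ⟨w, hw⟩ := h1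
          rw [hw]
          exact Ideal.mul_mem_right _ _ (Ideal.subset_span (by simp))
      obtain ⟨n, hn⟩ := hmD
      have hDhom : D.IsHomogeneous 2 :=
        ((auxLf_hom _).mul (auxLf_hom _)).sub ((auxLf_hom _).mul (auxLf_hom _))
      obtain ⟨x, y, hx, hy, hxy⟩ := aux_hom_factor (hn ▸ hDhom) (hn ▸ hD0)
      have := hx.inj_right hmhom hm
      obtain ⟨δ, rfl⟩ := aux_hom_zero (f := n) (by convert hy; omega)
      have hδ : δ ≠ 0 := by rintro rfl; exact hD0 (by rw [hn]; simp)
      refine fin δ hδ ?_ ?_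
      · have := mul_left_cancel₀ hm (a := m) (b := C δ * g (b 0)) (by rw [← g0, hn]; ring)
        rw [this]
        exact sub_mem (Ideal.mul_mem_right _ _ (hr _)) (Ideal.mul_mem_right _ _ (hr _))
      · have := mul_left_cancel₀ hm (a := m) (b := C δ * g (b 1)) (by rw [← g1, hn]; ring)
        rw [this]
        exact sub_mem (Ideal.mul_mem_left _ _ (hr _)) (Ideal.mul_mem_left _ _ (hr _))

open MvPolynomial in
theorem aux_final {k : Type*} [Field k] [IsAlgClosed k] {H : Type*} [AddCommGroup H] [Module k H]
    [FiniteDimensional k H] (hH : Module.finrank k H = 4)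
    (g : H →ₗ[k] MvPolynomial (Fin 4) k) (q : MvPolynomial (Fin 4) k) {e : ℕ} (he : e = 2 ∨ e = 3)
    (hg : ∀ v, (g v).IsHomogeneous e) (hq : q.IsHomogeneous e)
    (nz : ∀ a, (∀ v, eval a (g v) = 0) → eval a q = 0 → a = 0)
    {M : Type*} [AddCommGroup M] [Module k M] [FiniteDimensional k M] (hM : Module.finrank k M = 3)
    (ℓ : M →ₗ[k] (Fin 4 → H)) (hsyz : ∀ c, ∑ i, X i * g (ℓ c i) = 0) (hℓ0 : ∀ c, ℓ c 0 = 0)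
    (s : Fin 4 → k) (hs : ∀ c, ∑ i, s i • ℓ c i = 0 → c = 0) : False := by
  classical
  have hℓ : Function.Injective ℓ := by
    rw [← LinearMap.ker_eq_bot, Submodule.eq_bot_iff]
    intro c hc
    apply hs
    rw [LinearMap.mem_ker] at hc
    simp [hc]
  -- the case of a kernel
  have caseA : ∀ c : H, c ≠ 0 → g c = 0 → False := by
    intro c hc hgc
    let N : Submodule k H := Submodule.span k {c}
    have hN : N ≤ LinearMap.ker g := by
      rw [Submodule.span_singleton_le_iff_mem]; exact hgc
    let g' := N.liftQ g hN
    have hg' : ∀ v, g' (N.mkQ v) = g v := fun v => N.liftQ_apply g v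
    have hfr : Module.finrank k (H ⧸ N) = 3 := by
      have h1 := N.finrank_quotient_add_finrank
      have h2 : Module.finrank k N = 1 := finrank_span_singleton hc
      omega
    let V : M →ₗ[k] H := ∑ i, s i • (LinearMap.proj i ∘ₗ ℓ)
    have hV : ∀ c, V c = ∑ i, s i • ℓ c i := by intro c; simp [V]
    have hVinj : Function.Injective V := by
      rw [← LinearMap.ker_eq_bot, Submodule.eq_bot_iff]
      intro c hc
      exact hs c (by rw [← hV]; exact hc)
    let W := N.mkQ ∘ₗ V
    have hker : Module.finrank k (LinearMap.ker W) ≤ 1 := by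
      have : Module.finrank k ((LinearMap.ker W).map V) ≤ Module.finrank k N := by
        apply Submodule.finrank_mono
        rintro _ ⟨c, hc, rfl⟩
        have : N.mkQ (V c) = 0 := hc
        simpa using this
      rw [← (Submodule.equivMapOfInjective V hVinj (LinearMap.ker W)).finrank_eq] at this
      rw [finrank_span_singleton hc] at this
      exact this
    have hrange : 2 ≤ Module.finrank k (LinearMap.range W) := by
      have := LinearMap.finrank_range_add_finrank_ker W
      omega
    let bb := Module.finBasis k (LinearMap.range W)
    obtain ⟨w1, hw1⟩ := (bb ⟨0, by omega⟩).2
    obtain ⟨w2, hw2⟩ := (bb ⟨1, by omega⟩).2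
    have hind : LinearIndependent k ![W w1, W w2] := by
      have h1 := (bb.linearIndependent.map' (LinearMap.range W).subtype (Submodule.ker_subtype _)).comp
        (![⟨0, by omega⟩, ⟨1, by omega⟩] : Fin 2 → Fin (Module.finrank k (LinearMap.range W)))
        (by
          intro i j hij
          fin_cases i <;> fin_cases j <;> simp_all)
      have h2 : ![W w1, W w2] = ((LinearMap.range W).subtype ∘ bb) ∘
          (![⟨0, by omega⟩, ⟨1, by omega⟩] : Fin 2 → Fin (Module.finrank k (LinearMap.range W))) := by
        funext i
        fin_cases i
        · exact hw1
        · exact hw2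
      rw [h2]
      exact h1
    have hWs : ∀ c, W c = ∑ i, s i • N.mkQ (ℓ c i) := by
      intro c
      change N.mkQ (V c) = _
      rw [hV, map_sum]
      simp only [map_smul]
    have hgsurj : ∀ v, ∃ w, g' v = g w := by
      intro v
      obtain ⟨w, rfl⟩ := N.mkQ_surjective v
      exact ⟨w, hg' w⟩
    refine aux_caseA hfr g' q (e := e) (by omega) ?_ hq ?_
      (fun i => N.mkQ (ℓ w1 i)) (fun i => N.mkQ (ℓ w2 i)) ?_ ?_ ?_ ?_ s ?_
    · intro v
      obtain ⟨w, hw⟩ := hgsurj v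
      rw [hw]; exact hg w
    · intro a ha
      exact nz a (fun v => by rw [← hg']; exact ha _)
    · simp [hℓ0]
    · simp [hℓ0]
    · simp only [hg']; exact hsyz w1
    · simp only [hg']; exact hsyz w2
    · rw [← hWs, ← hWs]; exact hind
  let bM := Module.finBasisOfFinrankEq k M hM
  obtain ⟨u, p, hu, hp, hup⟩ := aux_hopf hH (fun i j => ℓ (bM i) j.succ)
  let c := ∑ i, u i • bM i
  have hc : c ≠ 0 := by
    intro h
    exact hu (funext fun i => Fintype.linearIndependent_iff.1 bM.linearIndependent u h i)
  have hcs : ∑ j, p j • ℓ c j.succ = 0 := by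
    rw [← hup, Finset.sum_comm]
    refine Finset.sum_congr rfl fun j _ => ?_
    simp only [c, map_sum, map_smul, Finset.sum_apply, Pi.smul_apply, Finset.smul_sum, smul_smul]
    exact Finset.sum_congr rfl fun i _ => by rw [mul_comm]
  have hlne : ∃ i, ℓ c i ≠ 0 := by
    by_contra hcon
    push Not at hcon
    exact hc (hℓ (by rw [map_zero]; exact funext hcon))
  obtain ⟨i0, hi0⟩ := hlne
  rcases aux_rank2 (ℓ c) (hℓ0 c) p hp hcs with ⟨A, y, hA⟩ | ⟨A, B, y, z, hAB, hyz, hl⟩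
  · have hA0 : A ≠ 0 := by rintro rfl; exact hi0 (by simp [hA])
    have hy0 : y ≠ 0 := by rintro rfl; exact hi0 (by simp [hA])
    refine caseA A hA0 ?_
    have := aux_syz g (ℓ c) (fun _ : Fin 1 => A) (fun _ => y) (by simpa using hA)
    rw [hsyz] at this
    simp only [Finset.univ_unique, Finset.sum_const, Finset.card_singleton, one_smul] at this
    exact (mul_eq_zero.1 this.symm).resolve_left (auxLf_prime hy0).ne_zero
  · have := aux_syz g (ℓ c) ![A, B] ![y, z] (by simpa using hl)
    rw [hsyz] at this
    simp only [Fin.sum_univ_two, Matrix.cons_val_zero, Matrix.cons_val_one] at this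
    obtain ⟨m, hm1, hm2⟩ := aux_two_term hyz this.symm
    by_cases hm : m = 0
    · exact caseA A (hAB.ne_zero 0) (by rw [hm1, hm, mul_zero])
    obtain ⟨E, hE⟩ := exists_linearIndependent_cons_of_lt_finrank hAB (by rw [hH]; norm_num)
    obtain ⟨D, hD⟩ := exists_linearIndependent_cons_of_lt_finrank hE (by rw [hH]; norm_num)
    let b := basisOfLinearIndependentOfCardEqFinrank hD (by simp [hH])
    have hb2 : b 2 = A := by
      simp only [b, coe_basisOfLinearIndependentOfCardEqFinrank]; rfl
    have hb3 : b 3 = B := by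
      simp only [b, coe_basisOfLinearIndependentOfCardEqFinrank]; rfl
    obtain ⟨c', hc'⟩ := exists_linearIndependent_pair_of_one_lt_finrank (R := k) (by rw [hM]; norm_num) hc
    obtain ⟨c'', hc''⟩ := exists_linearIndependent_cons_of_lt_finrank hc' (by rw [hM]; norm_num)
    refine aux_caseB g q he hg hq nz ℓ hsyz hℓ b y z hyz m hm (by rw [hb2, hm1]) (by rw [hb3, hm2])
      c (by rw [hb2, hb3]; exact hl) c' c'' ?_
    intro α β κ h
    have h1 := Fintype.linearIndependent_iff.1 hc'' ![β, -κ, α] (by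
      rw [Fin.sum_univ_three]
      change β • c'' + (-κ) • c + α • c' = 0
      rw [neg_smul, ← h]; abel)
    exact ⟨h1 2, h1 0⟩

open scoped TensorProduct in
open MvPolynomial in
theorem aux_deriv {K Ω : Type*} [Field K] [CharZero K] [Field Ω] [Algebra K Ω] {n : ℕ}
    (z : Fin n → Ω) (hz : AlgebraicIndependent K z) :
    ∃ D : Fin n → Derivation K Ω Ω, ∀ i j, D i (z j) = if i = j then 1 else 0 := by
  classical
  obtain ⟨t, hzt, ht⟩ := exists_isTranscendenceBasis_superset (R := K) (s := Set.range z)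
    (AlgebraicIndependent.to_subtype_range hz)
  have hzi : Function.Injective z := hz.injective
  let S := MvPolynomial t K
  let : Algebra S Ω := (aeval (fun y : t => (y : Ω)) : S →ₐ[K] Ω).toRingHom.toAlgebra
  have hmap : ∀ p : S, algebraMap S Ω p = aeval (fun y : t => (y : Ω)) p := fun p => rfl
  have : IsScalarTower K S Ω := IsScalarTower.of_algebraMap_eq fun r => by
    rw [hmap]; exact (AlgHom.commutes _ r).symm
  have : FaithfulSMul S Ω := (faithfulSMul_iff_algebraMap_injective S Ω).2 ht.1
  have alg : Algebra.IsAlgebraic S Ω := by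
    have h := ht.isAlgebraic
    refine ⟨fun a => ?_⟩
    have := h.1 a
    exact IsAlgebraic.of_ringHom_of_comp_eq
      (ht.1.aevalEquiv.toRingEquiv) (RingHom.id Ω)
      this ht.1.aevalEquiv.surjective Function.injective_id
      (RingHom.ext fun p => by simp; rfl)
  let Q := FractionRing S
  let : Algebra Q Ω := FractionRing.liftAlgebra S Ω
  have : IsScalarTower S Q Ω := inferInstance
  have : Algebra.IsAlgebraic Q Ω := (IsFractionRing.comap_isAlgebraic_iff (A := S) (K := Q) (C := Ω)).1 alg
  have : CharZero Q := inferInstance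
  have : Algebra.FormallyEtale S Q := Algebra.FormallyEtale.of_isLocalization (nonZeroDivisors S)
  have : Algebra.FormallyEtale Q Ω := Algebra.FormallyEtale.of_isSeparable Q Ω
  have : Algebra.FormallyEtale S Ω := Algebra.FormallyEtale.comp S Q Ω
  have key : ∀ c : t → Ω, ∃ D : Derivation K Ω Ω, ∀ y : t, D y = c y := by
    intro c
    let d : Derivation K S Ω := mkDerivation K c
    let f : Ω ⊗[S] Ω[S⁄K] →ₗ[Ω] Ω := LinearMap.liftBaseChange Ω d.liftKaehlerDifferential
    let L := f ∘ₗ (KaehlerDifferential.tensorKaehlerEquivOfFormallyEtale K S Ω).symm.toLinearMap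
    refine ⟨L.compDer (KaehlerDifferential.D K Ω), fun y => ?_⟩
    have h1 : (y : Ω) = algebraMap S Ω (X y) := by rw [hmap]; simp
    rw [h1]
    change f ((KaehlerDifferential.tensorKaehlerEquivOfFormallyEtale K S Ω).symm
      (KaehlerDifferential.D K Ω (algebraMap S Ω (X y)))) = _
    rw [KaehlerDifferential.tensorKaehlerEquivOfFormallyEtale_symm_D_algebraMap]
    simp only [f, d, LinearMap.liftBaseChange_tmul, one_smul, Derivation.liftKaehlerDifferential_comp_D]
    exact mkDerivation_X K c y
  choose D hD using fun i : Fin n => key (fun y => if z i = y then 1 else 0)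
  refine ⟨D, fun i j => ?_⟩
  have := hD i ⟨z j, hzt ⟨j, rfl⟩⟩
  simpa [hzi.eq_iff] using this

open MvPolynomial in
theorem aux_chain {K Ω σ : Type*} [Fintype σ] [Field K] [CommRing Ω] [Algebra K Ω]
    (D : Derivation K Ω Ω) (v : σ → Ω) (p : MvPolynomial σ K) :
    D (aeval v p) = ∑ i, aeval v (pderiv i p) * D (v i) := by
  classical
  induction p using MvPolynomial.induction_on with
  | C a => simp [← MvPolynomial.algebraMap_eq]
  | add p q hp hq => simp [hp, hq, add_mul, Finset.sum_add_distrib]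
  | mul_X p i hp =>
    simp only [map_mul, Derivation.leibniz, hp, aeval_X, pderiv_X, smul_eq_mul, map_add,
      add_mul, Finset.sum_add_distrib]
    congr 1
    · rw [Finset.sum_eq_single i]
      · simp
      · intro b _ hb; simp [hb, Pi.single_apply, Ne.symm hb]
      · simp
    · rw [Finset.mul_sum]; exact Finset.sum_congr rfl fun _ _ => by ring

open MvPolynomial in
theorem aux_trdeg {K : Type*} [Field K] {m n : ℕ} (p : Fin (n + 1) → Ideal (MvPolynomial (Fin m) K))
    (hp : ∀ i, (p i).IsPrime) (hmono : StrictMono p) :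
    ∃ z : Fin n → MvPolynomial (Fin m) K ⧸ p 0, AlgebraicIndependent K z := by
  obtain ⟨s, -, g, hgi, hgint⟩ := exists_integral_inj_algHom_of_quotient (p 0) (hp 0).ne_top
  let _ : Algebra (MvPolynomial (Fin s) K) (MvPolynomial (Fin m) K ⧸ p 0) := g.toRingHom.toAlgebra
  have : Algebra.IsIntegral (MvPolynomial (Fin s) K) (MvPolynomial (Fin m) K ⧸ p 0) := ⟨hgint⟩
  have hle : ∀ i, p 0 ≤ p i := fun i => hmono.monotone (Fin.zero_le _)
  let q : Fin (n + 1) → Ideal (MvPolynomial (Fin m) K ⧸ p 0) := fun i => (p i).map (Ideal.Quotient.mk (p 0))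
  have hq : ∀ i, (q i).IsPrime := fun i =>
    Ideal.map_isPrime_of_surjective (H := hp i) Ideal.Quotient.mk_surjective (by simpa using hle i)
  have hqc : ∀ i, (q i).comap (Ideal.Quotient.mk (p 0)) = p i := fun i => by
    simp [q, Ideal.comap_map_of_surjective _ Ideal.Quotient.mk_surjective, ← RingHom.ker_eq_comap_bot, hle i]
  have hqm : ∀ i j, i < j → q i < q j := by
    intro i j hij
    refine lt_of_le_of_ne (Ideal.map_mono (hmono hij).le) fun h => (hmono hij).ne ?_
    rw [← hqc i, ← hqc j, h]
  let r : Fin (n + 1) → PrimeSpectrum (MvPolynomial (Fin s) K) := fun i =>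
    ⟨(q i).comap (algebraMap _ _), (hq i).comap _⟩
  have hr : StrictMono r := fun i j hij => by
    have := hq i
    exact Ideal.IsIntegral.comap_lt_comap (R := MvPolynomial (Fin s) K) (hqm i j hij)
  have h1 : ((n : ℕ) : WithBot ℕ∞) ≤ ringKrullDim (MvPolynomial (Fin s) K) :=
    Order.le_krullDim_iff.2 ⟨LTSeries.mk n r hr, rfl⟩
  rw [MvPolynomial.ringKrullDim_of_isNoetherianRing, ringKrullDim_eq_zero_of_field] at h1
  have hns : n ≤ s := by simpa using h1
  refine ⟨fun i => g (X (Fin.castLE hns i)), ?_⟩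
  have h2 : AlgebraicIndependent K (fun i : Fin s => g (X i)) := by
    have := (MvPolynomial.algebraicIndependent_X (Fin s) K).map' (f := g) hgi
    exact this
  exact h2.comp _ (Fin.castLE_injective hns)

open MvPolynomial in
theorem aux_eval_smul {σ k : Type*} [Field k] {f : MvPolynomial σ k} {e : ℕ}
    (hf : f.IsHomogeneous e) (c : k) (v : σ → k) : eval (c • v) f = c ^ e * eval v f := by
  rw [eval_eq, eval_eq, Finset.mul_sum]
  refine Finset.sum_congr rfl fun d hd => ?_
  have : ∑ i ∈ d.support, d i = e := by
    have := hf (mem_support_iff.1 hd)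
    simpa [Finsupp.weight_apply, Finsupp.sum] using this
  simp only [Pi.smul_apply, smul_eq_mul, mul_pow, Finset.prod_mul_distrib, Finset.prod_pow_eq_pow_sum, this]
  ring

/-- affine cone -/
def auxCone {N : ℕ} (W : Set (Pn N)) : Set (Fin (N + 1) → KK) :=
  {v | ∃ y ∈ W, ∃ c : KK, v = c • y.rep}

open MvPolynomial in
theorem aux_cone_hom {N : ℕ} {W : Set (Pn N)} {f : MvPolynomial (Fin (N + 1)) KK} {e : ℕ}
    (hf : f.IsHomogeneous e) (h : ∀ y ∈ W, eval y.rep f = 0) :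
    f ∈ vanishingIdeal KK (auxCone W) := by
  rintro v ⟨y, hy, c, rfl⟩
  rw [aeval_eq_eval]
  exact (aux_eval_smul hf c _).trans (by rw [h y hy, mul_zero])

open MvPolynomial in
theorem aux_cone_prime {N : ℕ} {W : Set (Pn N)} (hW : ProjIrred W) :
    (vanishingIdeal KK (auxCone W)).IsPrime := by
  let _ := MvPolynomial.gradedAlgebra (σ := Fin (N + 1)) (R := KK)
  have hmem : ∀ y ∈ W, y.rep ∈ auxCone W := fun y hy => ⟨y, hy, 1, by simp⟩
  refine Ideal.IsHomogeneous.isPrime_of_homogeneous_mem_or_mem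
    (𝒜 := homogeneousSubmodule (Fin (N + 1)) KK) ?_ ?_ ?_
  · intro e f hf
    have h0 : homogeneousComponent e f ∈ vanishingIdeal KK (auxCone W) := by
      refine aux_cone_hom (homogeneousComponent_isHomogeneous e f) fun y hy => ?_
      let P : Polynomial KK := ∑ i ∈ Finset.range (f.totalDegree + 1),
        Polynomial.monomial i (eval y.rep (homogeneousComponent i f))
      have hP : P = 0 := by
        refine Polynomial.funext fun t => ?_
        have := hf (t • y.rep) ⟨y, hy, t, rfl⟩
        rw [aeval_eq_eval] at this
        change eval (t • y.rep) f = 0 at this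
        rw [← sum_homogeneousComponent f, map_sum] at this
        simp only [P, Polynomial.eval_finset_sum, Polynomial.eval_monomial, Polynomial.eval_zero]
        rw [← this]
        refine Finset.sum_congr rfl fun i _ => ?_
        rw [aux_eval_smul (homogeneousComponent_isHomogeneous i f), mul_comm]
      by_cases he : e ≤ f.totalDegree
      · have := congrArg (fun p => p.coeff e) hP
        simpa [P, Polynomial.finset_sum_coeff, Polynomial.coeff_monomial, Nat.lt_succ_iff, he] using this
      · rw [homogeneousComponent_eq_zero _ _ (by omega)]; simp
    have h1 := MvPolynomial.decomposition.decompose'_apply f e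
    change _ at h1
    rw [← h1] at h0
    convert h0
    rfl
  · intro h
    obtain ⟨y, hy⟩ := hW.1
    have : (1 : MvPolynomial (Fin (N + 1)) KK) ∈ vanishingIdeal KK (auxCone W) := by rw [h]; trivial
    simpa using this _ (hmem y hy)
  · rintro f g ⟨a, ha⟩ ⟨b, hb⟩ hfg
    have ha' : f.IsHomogeneous a := ha
    have hb' : g.IsHomogeneous b := hb
    have hcl : ∀ (f : MvPolynomial (Fin (N + 1)) KK) (a : ℕ), f.IsHomogeneous a →
        ProjClosed {y : Pn N | eval y.rep f = 0} := fun f a h => ⟨{f}, by simpa using ⟨a, h⟩, by simp [projZeros]⟩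
    rcases hW.2 _ _ (hcl f a ha') (hcl g b hb') (fun y hy => by
      have := hfg _ (hmem y hy)
      rw [aeval_eq_eval] at this
      have h2 : eval y.rep (f * g) = 0 := this
      simpa using h2) with h | h
    · exact Or.inl (aux_cone_hom ha' fun y hy => h hy)
    · exact Or.inr (aux_cone_hom hb' fun y hy => h hy)

open MvPolynomial in
theorem aux_dim {N n : ℕ} {V : Set (Pn N)} (h : ((n : ℕ) : WithBot ℕ∞) ≤ projDim V) :
    ∃ W ⊆ V, (vanishingIdeal KK (auxCone W)).IsPrime ∧
      ∃ z : Fin (n + 1) → MvPolynomial (Fin (N + 1)) KK ⧸ vanishingIdeal KK (auxCone W),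
        AlgebraicIndependent KK z := by
  obtain ⟨l, hl⟩ := Order.le_krullDim_iff.1 h
  subst hl
  let I : Fin (l.length + 1) → Ideal (MvPolynomial (Fin (N + 1)) KK) :=
    fun i => vanishingIdeal KK (auxCone (l i.rev).1)
  have hI : ∀ i, (I i).IsPrime := fun i => aux_cone_prime (l i.rev).2.1.2
  have hmem : ∀ (W : Set (Pn N)), ∀ y ∈ W, y.rep ∈ auxCone W := fun W y hy => ⟨y, hy, 1, by simp⟩
  have hIm : StrictMono I := by
    intro i j hij
    have hlt : l j.rev < l i.rev := l.strictMono (Fin.rev_lt_rev.2 hij)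
    have hsub : (l j.rev).1 ⊆ (l i.rev).1 := hlt.le
    refine lt_of_le_of_ne (vanishingIdeal_anti_mono ?_) fun he => ?_
    · rintro v ⟨y, hy, c, rfl⟩; exact ⟨y, hsub hy, c, rfl⟩
    · obtain ⟨S, hS, hSe⟩ := (l j.rev).2.1.1
      refine hlt.not_ge ?_
      change (l i.rev).1 ⊆ (l j.rev).1
      intro y hy
      rw [hSe]
      intro f hf
      obtain ⟨e, hfe⟩ := hS f hf
      have h1 : f ∈ I j := aux_cone_hom hfe fun y hy => by rw [hSe] at hy; exact hy f hf
      rw [← he] at h1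
      have := h1 _ (hmem _ y hy)
      rwa [aeval_eq_eval] at this
  let M : Ideal (MvPolynomial (Fin (N + 1)) KK) := RingHom.ker (eval (0 : Fin (N + 1) → KK))
  have hIM : I (Fin.last _) < M := by
    obtain ⟨y, hy⟩ := (l (Fin.last _).rev).2.1.2.1
    refine lt_of_le_of_ne (fun f hf => ?_) fun he => y.rep_nonzero ?_
    · have := hf 0 ⟨y, hy, 0, by simp⟩
      rwa [aeval_eq_eval] at this
    · funext i
      have h1 : (X i : MvPolynomial (Fin (N + 1)) KK) ∈ M := by simp [M, RingHom.mem_ker]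
      rw [← he] at h1
      simpa using h1 _ (hmem _ y hy)
  let p : Fin (l.length + 1 + 1) → Ideal (MvPolynomial (Fin (N + 1)) KK) := Fin.snoc I M
  have hz := aux_trdeg p (by
      intro i
      induction i using Fin.lastCases with
      | last => simp only [p, Fin.snoc_last]; exact RingHom.ker_isPrime _
      | cast i => simp only [p, Fin.snoc_castSucc]; exact hI i) (by
    rw [Fin.strictMono_iff_lt_succ]
    intro i
    induction i using Fin.lastCases with
    | last => simp only [p, Fin.succ_last, Fin.snoc_last, Fin.snoc_castSucc]; exact hIM
    | cast i =>
      rw [← Fin.castSucc_succ]; simp only [p, Fin.snoc_castSucc]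
      exact hIm (Fin.castSucc_lt_succ))
  have hp0 : p 0 = I 0 := by
    simp only [p]; rw [← Fin.castSucc_zero, Fin.snoc_castSucc]
  rw [hp0] at hz
  exact ⟨_, (l _).2.2, hI 0, hz⟩

theorem aux_seven {Ω V : Type*} [Field Ω] [AddCommGroup V] [Module Ω V] [FiniteDimensional Ω V]
    (T : Submodule Ω V) (hT : Module.finrank Ω T = 4) (v : Fin 7 → V) (hv : LinearIndependent Ω v) :
    ∃ c : Fin 3 → Fin 7 → Ω, LinearIndependent Ω (fun m => T.mkQ (∑ n, c m n • v n)) := by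
  let A : (Fin 7 → Ω) →ₗ[Ω] V := Fintype.linearCombination Ω v
  have hA : Function.Injective A := by
    rw [← LinearMap.ker_eq_bot, LinearMap.ker_eq_bot']
    intro c hc
    funext n
    exact Fintype.linearIndependent_iff.1 hv c hc n
  let E := T.mkQ ∘ₗ A
  have h1 := LinearMap.finrank_range_add_finrank_ker E
  have h2 : Module.finrank Ω (LinearMap.ker E) ≤ 4 := by
    rw [← hT]
    let B : LinearMap.ker E →ₗ[Ω] T := (A.domRestrict (LinearMap.ker E)).codRestrict T (by
      rintro ⟨c, hc⟩
      simpa [E] using hc)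
    refine LinearMap.finrank_le_finrank_of_injective (f := B) ?_
    rintro ⟨a, ha⟩ ⟨b, hb⟩ hab
    exact Subtype.ext (hA (congrArg Subtype.val hab))
  have h3 : 3 ≤ Module.finrank Ω (LinearMap.range E) := by
    simp at h1; omega
  obtain ⟨f, hf⟩ := exists_linearIndependent_of_le_finrank h3
  choose c hc using fun m => (f m).2
  refine ⟨c, ?_⟩
  have h4 : (fun m => T.mkQ (∑ n, c m n • v n)) = (LinearMap.range E).subtype ∘ f := by
    funext m
    simp only [Function.comp, Submodule.subtype_apply]
    rw [← hc m]
    rfl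
  rw [h4]
  exact hf.map' _ (Submodule.ker_subtype _)

open MvPolynomial in
theorem aux_nonsing {K Ω : Type*} [Field K] [IsAlgClosed K] [Field Ω] [Algebra K Ω] {n : ℕ}
    (F : MvPolynomial (Fin n) K) (hns : ∀ z, (∀ i, eval z (pderiv i F) = 0) → z = 0)
    (p : Fin n → Ω) (hp : ∀ i, aeval p (pderiv i F) = 0) : p = 0 := by
  funext i
  let I : Ideal (MvPolynomial (Fin n) K) := Ideal.span (Set.range fun i => pderiv i F)
  have h1 : X i ∈ vanishingIdeal K (zeroLocus K I) := by
    intro z hz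
    have : z = 0 := hns z fun j => by
      have := hz (pderiv j F) (Ideal.subset_span ⟨j, rfl⟩)
      rwa [aeval_eq_eval] at this
    simp [this]
  rw [vanishingIdeal_zeroLocus_eq_radical] at h1
  obtain ⟨N, hN⟩ := h1
  have h2 : I ≤ RingHom.ker (aeval p : MvPolynomial (Fin n) K →ₐ[K] Ω) := by
    rw [Ideal.span_le]
    rintro _ ⟨j, rfl⟩
    exact hp j
  have h3 : aeval p (X i ^ N : MvPolynomial (Fin n) K) = 0 := h2 hN
  simp only [map_pow, aeval_X] at h3
  exact eq_zero_of_pow_eq_zero h3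

open MvPolynomial in
theorem aux_ext {K Ω : Type*} [Field K] [CharZero K] [Field Ω] [Algebra K Ω] {n : ℕ}
    (p : MvPolynomial (Fin n) Ω) (h : ∀ a : Fin n → K, eval (fun i => algebraMap K Ω (a i)) p = 0) :
    p = 0 := by
  refine funext_set (fun _ => Set.range (algebraMap K Ω))
    (fun _ => Set.infinite_range_of_injective (algebraMap K Ω).injective) fun z hz => ?_
  choose a ha using fun i => hz i (Set.mem_univ i)
  have : z = fun i => algebraMap K Ω (a i) := funext fun i => (ha i).symm
  rw [this, h, map_zero]

open MvPolynomial in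
set_option maxHeartbeats 2000000 in
theorem aux_core {K Ω : Type*} [Field K] [CharZero K] [IsAlgClosed K] [Field Ω] [IsAlgClosed Ω]
    [Algebra K Ω] {d : ℕ} (hd : d = 3 ∨ d = 4) (F : MvPolynomial (Fin 9) K)
    (hF : F.IsHomogeneous d) (hns : ∀ z, (∀ i, eval z (pderiv i F) = 0) → z = 0)
    (w : Fin 4 → Fin 9 → Ω) (hw : LinearIndependent Ω w) (x : Fin 9 → K) (hx0 : x ≠ 0)
    (hwx : ∀ i, w 0 i = algebraMap K Ω (x i))
    (hFw : ∀ a : Fin 4 → K, aeval (fun i => ∑ j, algebraMap K Ω (a j) * w j i) F = 0)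
    (s : Fin 4 → Ω) (D : Fin 7 → Derivation K Ω Ω)
    (hD : LinearIndependent Ω (fun n i => D n (∑ j, s j * w j i))) : False := by
  classical
  let u : Fin 9 → MvPolynomial (Fin 4) Ω := fun i => ∑ j, C (w j i) * X j
  have hu : ∀ a i, eval a (u i) = ∑ j, a j * w j i := fun a i => by
    simp [u, mul_comm]
  have huh : ∀ i, (u i).IsHomogeneous 1 := fun i =>
    IsHomogeneous.sum _ _ _ fun j _ => by
      simpa using (isHomogeneous_C (Fin 4) (w j i)).mul (isHomogeneous_X Ω j)
  have hea : ∀ a (p : MvPolynomial (Fin 9) K), eval a (aeval u p) = aeval (fun i => ∑ j, a j * w j i) p := by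
    intro a p
    have : (fun i => ∑ j, a j * w j i) = fun i => eval a (u i) := funext fun i => (hu a i).symm
    rw [this]
    induction p using MvPolynomial.induction_on with
    | C r => simp [IsScalarTower.algebraMap_apply K Ω (MvPolynomial (Fin 4) Ω)]
    | add p q hp hq => simp [hp, hq]
    | mul_X p i hp => simp [hp]
  have huF : aeval u F = 0 := aux_ext (K := K) _ fun a => by rw [hea]; exact hFw a
  let g0 : Fin 9 → MvPolynomial (Fin 4) Ω := fun i => aeval u (pderiv i F)
  have hg0 : ∀ i, (g0 i).IsHomogeneous (d - 1) := fun i => by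
    simpa using (hF.pderiv (i := i)).aeval u huh
  let G : (Fin 9 → Ω) →ₗ[Ω] MvPolynomial (Fin 4) Ω := Fintype.linearCombination Ω g0
  have hG : ∀ v, G v = ∑ i, C (v i) * g0 i := fun v => by
    simp [G, Fintype.linearCombination_apply, MvPolynomial.smul_eq_C_mul]
  have hGh : ∀ v, (G v).IsHomogeneous (d - 1) := fun v => by
    rw [hG]
    exact IsHomogeneous.sum _ _ _ fun i _ => by
      simpa using (isHomogeneous_C (Fin 4) (v i)).mul (hg0 i)
  have hGw : ∀ j, G (w j) = 0 := by
    intro j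
    have h1 := aux_chain ((pderiv (R := Ω) j).restrictScalars K) u F
    rw [huF, map_zero] at h1
    rw [hG, h1]
    refine Finset.sum_congr rfl fun i _ => ?_
    have : (pderiv j) (u i) = C (w j i) := by
      simp only [u, map_sum, Derivation.leibniz, pderiv_C, pderiv_X, smul_eq_mul, mul_zero, add_zero]
      rw [Finset.sum_eq_single j]
      · simp
      · intro b _ hb; simp [hb]
      · simp
    change _ = _ * (pderiv j) (u i)
    rw [this, mul_comm]
  have hGD : ∀ δ : Derivation K Ω Ω, ∑ j, X j * G (fun i => δ (w j i)) = 0 := by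
    intro δ
    refine aux_ext (K := K) _ fun a => ?_
    have h1 := aux_chain δ (fun i => ∑ j, algebraMap K Ω (a j) * w j i) F
    rw [hFw a, map_zero] at h1
    simp only [map_sum, map_mul, eval_X, hG, eval_C, g0, hea]
    rw [h1]
    simp only [map_sum, Derivation.leibniz, Derivation.map_algebraMap, smul_eq_mul, mul_zero, add_zero]
    simp only [Finset.mul_sum]
    rw [Finset.sum_comm]
    exact Finset.sum_congr rfl fun i _ => Finset.sum_congr rfl fun j _ => by ring
  have hδ0 : ∀ δ : Derivation K Ω Ω, (fun i => δ (w 0 i)) = 0 := fun δ => funext fun i => by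
    rw [hwx]; exact δ.map_algebraMap _
  let e0 : Fin 4 → Ω := Pi.single 0 1
  let L : (Fin 9 → Ω) →ₗ[Ω] Ω := (aeval e0 : MvPolynomial (Fin 4) Ω →ₐ[Ω] Ω).toLinearMap ∘ₗ G
  have hL : ∀ v, L v = eval e0 (G v) := fun v => by
    simp only [L, LinearMap.comp_apply, AlgHom.toLinearMap_apply, aeval_eq_eval]
  have hLw : ∀ j, L (w j) = 0 := fun j => by rw [hL, hGw, map_zero]
  have hLD : ∀ (δ : Derivation K Ω Ω) j, L (fun i => δ (w j i)) = 0 := by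
    intro δ j
    have h1 := congrArg (fun p => eval e0 (pderiv j p)) (hGD δ)
    simp only [map_sum, Derivation.leibniz, pderiv_X, smul_eq_mul, map_add, map_mul, eval_X, map_zero,
      Finset.sum_add_distrib] at h1
    rw [Finset.sum_eq_single 0, Finset.sum_eq_single j] at h1
    · rw [hδ0 δ] at h1
      simpa [hL] using h1
    · intro b _ hb; simp [hb]
    · simp
    · intro b _ hb; simp [e0, hb]
    · simp
  have hnz : ∀ a, (∀ i, eval a (g0 i) = 0) → a = 0 := by
    intro a ha
    have h1 := aux_nonsing F hns (fun i => ∑ j, a j * w j i) fun i => by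
      rw [← hea]; exact ha i
    have h2 : ∑ j, a j • w j = 0 := by
      rw [← h1]; funext i; simp
    funext j
    exact Fintype.linearIndependent_iff.1 hw a h2 j
  have hGe : ∀ i, G (Pi.single i 1) = g0 i := fun i => by
    simp [G]
  have he0 : e0 ≠ 0 := fun h => by
    have := congrFun h 0
    simp [e0] at this
  let T : Submodule Ω (Fin 9 → Ω) := Submodule.span Ω (Set.range w)
  have hT : Module.finrank Ω T = 4 := by
    simpa using finrank_span_eq_card hw
  have hTG : T ≤ LinearMap.ker G := by
    rw [Submodule.span_le]; rintro _ ⟨j, rfl⟩; exact hGw j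
  have hTL : T ≤ LinearMap.ker L := by
    rw [Submodule.span_le]; rintro _ ⟨j, rfl⟩; exact hLw j
  let V := (Fin 9 → Ω) ⧸ T
  have hV : Module.finrank Ω V = 5 := by
    have := T.finrank_quotient_add_finrank
    simp [hT] at this
    omega
  let Gb : V →ₗ[Ω] MvPolynomial (Fin 4) Ω := T.liftQ G hTG
  let Lb : V →ₗ[Ω] Ω := T.liftQ L hTL
  have hGb : ∀ v, Gb (T.mkQ v) = G v := fun v => T.liftQ_apply G v
  have hLb : ∀ v, Lb (T.mkQ v) = L v := fun v => T.liftQ_apply L v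
  obtain ⟨b, hb⟩ : ∃ b, Lb b = 1 := by
    obtain ⟨i, hi⟩ : ∃ i, eval e0 (g0 i) ≠ 0 := by
      by_contra! h
      exact he0 (hnz e0 h)
    refine ⟨T.mkQ ((eval e0 (g0 i))⁻¹ • Pi.single i 1), ?_⟩
    rw [hLb, map_smul, hL, hGe, smul_eq_mul, inv_mul_cancel₀ hi]
  let H := LinearMap.ker Lb
  have hH : Module.finrank Ω H = 4 := by
    have h1 := LinearMap.finrank_range_add_finrank_ker Lb
    have h2 : LinearMap.range Lb = ⊤ := LinearMap.range_eq_top.2 fun r => ⟨r • b, by simp [hb]⟩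
    rw [h2, hV] at h1
    simp at h1
    change Module.finrank Ω (LinearMap.ker Lb) = 4
    omega
  obtain ⟨c, hc⟩ := aux_seven T hT _ hD
  let δ : Fin 3 → Derivation K Ω Ω := fun m => ∑ n, c m n • D n
  have hδ : ∀ m y, δ m y = ∑ n, c m n * D n y := fun m y => by
    simp only [δ]
    rw [show (∑ n, c m n • D n) y = Derivation.coeFnAddMonoidHom (∑ n, c m n • D n) y from rfl, map_sum, Finset.sum_apply]
    rfl
  have hcδ : LinearIndependent Ω (fun m => T.mkQ (fun i => δ m (∑ j, s j * w j i))) := by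
    convert hc using 3 with m
    funext i
    rw [hδ]
    simp
  let P : Fin 3 → Fin 4 → H := fun m j => ⟨T.mkQ (fun i => δ m (w j i)), by
    change Lb _ = 0
    rw [hLb, hLD]⟩
  let ℓ : (Fin 3 → Ω) →ₗ[Ω] (Fin 4 → H) := Fintype.linearCombination Ω P
  have hℓ : ∀ c j, ℓ c j = ∑ m, c m • P m j := fun c j => by
    simp [ℓ, Fintype.linearCombination_apply, Finset.sum_apply]
  have hgP : ∀ m j, (Gb ∘ₗ H.subtype) (P m j) = G (fun i => δ m (w j i)) := fun m j => hGb _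
  refine aux_final (e := d - 1) hH (Gb ∘ₗ H.subtype) (Gb b) (by omega) ?_ ?_ ?_ (M := Fin 3 → Ω)
    (by simp) ℓ ?_ ?_ s ?_
  · rintro ⟨v, hv⟩
    obtain ⟨v, rfl⟩ := T.mkQ_surjective v
    change (Gb (T.mkQ v)).IsHomogeneous _
    rw [hGb]; exact hGh v
  · obtain ⟨v, rfl⟩ := T.mkQ_surjective b
    rw [hGb]; exact hGh v
  · intro a h1 h2
    refine hnz a fun i => ?_
    have h3 : ∀ v, eval a (Gb v) = 0 := by
      intro v
      have h4 := h1 ⟨v - Lb v • b, by change Lb _ = 0; simp [hb]⟩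
      have h5 : (Gb ∘ₗ H.subtype) ⟨v - Lb v • b, by change Lb _ = 0; simp [hb]⟩ = Gb v - Lb v • Gb b := by
        change Gb (v - Lb v • b) = _
        simp
      rw [h5, map_sub, smul_eval, h2] at h4
      simpa using h4
    rw [← hGe, ← hGb]; exact h3 _
  · intro c
    simp only [hℓ, map_sum, map_smul, hgP]
    have h1 : ∀ m, ∑ j, X j * (c m • G (fun i => δ m (w j i))) = 0 := fun m => by
      simp only [mul_smul_comm]
      rw [← Finset.smul_sum, hGD, smul_zero]
    simp only [Finset.mul_sum]
    rw [Finset.sum_comm]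
    exact Finset.sum_eq_zero fun m _ => h1 m
  · intro c
    rw [hℓ]
    refine Finset.sum_eq_zero fun m _ => ?_
    have : P m 0 = 0 := Subtype.ext (by
      change T.mkQ (fun i => δ m (w 0 i)) = 0
      rw [hδ0, map_zero])
    rw [this, smul_zero]
  · intro c hc0
    have h1 : ∀ m, ∑ j, s j • T.mkQ (fun i => δ m (w j i)) = T.mkQ (fun i => δ m (∑ j, s j * w j i)) := by
      intro m
      have h2 : (fun i => δ m (∑ j, s j * w j i)) =
          ∑ j, s j • (fun i => δ m (w j i)) + ∑ j, δ m (s j) • w j := by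
        funext i
        simp only [map_sum, Derivation.leibniz, Finset.sum_add_distrib, Pi.add_apply, Finset.sum_apply,
          Pi.smul_apply, smul_eq_mul, mul_comm]
        exact add_comm _ _
      have h3 : T.mkQ (∑ j, δ m (s j) • w j) = 0 := by
        simp only [Submodule.mkQ_apply, Submodule.Quotient.mk_eq_zero]
        exact Submodule.sum_mem _ fun j _ => Submodule.smul_mem _ _ (Submodule.subset_span ⟨j, rfl⟩)
      rw [h2, map_add, h3, add_zero, map_sum]
      simp only [map_smul]
    have h4 := congrArg H.subtype hc0
    simp only [map_sum, map_smul, hℓ, map_zero] at h4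
    have h5 : ∑ m, c m • T.mkQ (fun i => δ m (∑ j, s j * w j i)) = 0 := by
      simp only [← h1]
      rw [← h4]
      simp only [Finset.smul_sum]
      rw [Finset.sum_comm]
      refine Finset.sum_congr rfl fun j _ => Finset.sum_congr rfl fun m _ => ?_
      rw [smul_comm]; rfl
    funext m
    exact Fintype.linearIndependent_iff.1 hcδ c h5 m

theorem aux_pickbasis {K V : Type*} [Field K] [AddCommGroup V] [Module K V] [FiniteDimensional K V]
    (h : Module.finrank K V = 4) (v : V) (hv : v ≠ 0) :
    ∃ b : Fin 4 → V, LinearIndependent K b ∧ b 0 = v := by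
  have h1 : LinearIndependent K ![v] := LinearIndependent.of_subsingleton (0 : Fin 1) (by simpa using hv)
  obtain ⟨v2, h2⟩ := exists_linearIndependent_cons_of_lt_finrank h1 (by omega)
  obtain ⟨v3, h3⟩ := exists_linearIndependent_cons_of_lt_finrank h2 (by omega)
  obtain ⟨v4, h4⟩ := exists_linearIndependent_cons_of_lt_finrank h3 (by omega)
  exact ⟨_, h4.comp Fin.rev Fin.rev_injective, rfl⟩

open MvPolynomial in
theorem aux_point {d : ℕ} (hd : d ≠ 0) (F : MvPolynomial (Fin (8 + 1)) KK) (hF : F.IsHomogeneous d)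
    (T : Submodule KK (Fin (8 + 1) → KK)) (hT : T ∈ Fano 3 8 (hyp F)) (x v : Fin 9 → KK) (hx0 : x ≠ 0)
    (hx : x ∈ T) (hv : v ∈ T) :
    ∃ (w φ : Fin 4 → Fin 9 → KK) (s : Fin 4 → KK), w 0 = x ∧
      (∀ i j, ∑ m, φ i m * w j m = if i = j then 1 else 0) ∧
      (∀ a : Fin 4 → KK, eval (fun i => ∑ j, a j * w j i) F = 0) ∧
      ∀ i, v i = ∑ j, s j * w j i := by
  classical
  obtain ⟨hfr, hTX⟩ := hT
  obtain ⟨b, hb, hb0⟩ := aux_pickbasis (K := KK) (V := T) (by simpa using hfr) ⟨x, hx⟩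
    (fun h => hx0 (congrArg Subtype.val h))
  let w : Fin 4 → Fin 9 → KK := fun j => (b j : Fin 9 → KK)
  have hw : LinearIndependent KK w := hb.map' T.subtype (Submodule.ker_subtype _)
  let B := basisOfLinearIndependentOfCardEqFinrank hb (by simpa using hfr.symm)
  let A : (Fin 4 → KK) →ₗ[KK] (Fin 9 → KK) := Fintype.linearCombination KK w
  obtain ⟨g, hg⟩ := LinearMap.exists_leftInverse_of_injective A
    (LinearMap.ker_eq_bot.2 (linearIndependent_iff_injective_fintypeLinearCombination.1 hw))
  refine ⟨w, fun i m => g (Pi.single m 1) i, B.repr ⟨v, hv⟩, ?_, ?_, ?_, ?_⟩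
  · exact congrArg Subtype.val hb0
  · intro i j
    have h1 : g (w j) = Pi.single j 1 := by
      have := LinearMap.congr_fun hg (Pi.single j 1)
      simpa [A] using this
    have h2 : w j = ∑ m, w j m • Pi.single m (1 : KK) := by
      funext n; simp [Finset.sum_apply, Pi.single_apply]
    have h3 := congrFun h1 i
    rw [h2, map_sum, Finset.sum_apply] at h3
    simp only [map_smul, Pi.smul_apply, smul_eq_mul] at h3
    rw [Pi.single_apply] at h3
    rw [← h3]
    exact Finset.sum_congr rfl fun m _ => mul_comm _ _
  · intro a
    have hu : (fun i => ∑ j, a j * w j i) = ∑ j, a j • w j := by funext i; simp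
    rw [hu]
    have hmem : ∑ j, a j • w j ∈ T := Submodule.sum_mem _ fun j _ => T.smul_mem _ (b j).2
    generalize ∑ j, a j • w j = u at hmem
    by_cases h0 : u = 0
    · rw [h0]; exact aux_hom_eval0 hF hd
    · obtain ⟨c, hc⟩ := Projectivization.exists_smul_eq_mk_rep KK u h0
      have h1 : Projectivization.mk KK u h0 ∈ planeSet T := by
        change Projectivization.rep _ ∈ T
        rw [← hc]; exact T.smul_mem _ hmem
      have h2 : eval (Projectivization.mk KK u h0).rep F = 0 := hTX h1
      rw [← hc] at h2
      have h3 := aux_eval_smul hF (c : KK) u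
      change eval ((c : KK) • u) F = 0 at h2
      rw [h2] at h3
      exact (mul_eq_zero.1 h3.symm).resolve_left (pow_ne_zero _ c.ne_zero)
  · intro i
    have := congrArg (fun t : T => (t : Fin 9 → KK) i) (B.sum_repr ⟨v, hv⟩)
    simp only [B, coe_basisOfLinearIndependentOfCardEqFinrank, Submodule.coe_sum, Submodule.coe_smul,
      Finset.sum_apply, Pi.smul_apply, smul_eq_mul] at this
    exact this.symm

open MvPolynomial in
theorem aux_main {d : ℕ} (hd : d = 3 ∨ d = 4) (F : MvPolynomial (Fin (8 + 1)) KK)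
    (hF : F.IsHomogeneous d) (hns : NonsingularK F) (x : Pn 8)
    (hdim : ((6 : ℕ) : WithBot ℕ∞) ≤
      projDim {y : Pn 8 | ∃ T ∈ Fano 3 8 (hyp F), x.rep ∈ T ∧ y.rep ∈ T}) : False := by
  classical
  obtain ⟨W, hW, hP, z, hz⟩ := aux_dim hdim
  let P := vanishingIdeal KK (auxCone W)
  let J := auxCone W
  have hpt : ∀ v : J, ∃ T ∈ Fano 3 8 (hyp F), x.rep ∈ T ∧ (v : Fin 9 → KK) ∈ T := by
    rintro ⟨_, y, hy, c, rfl⟩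
    obtain ⟨T, hT, h1, h2⟩ := hW hy
    exact ⟨T, hT, h1, T.smul_mem _ h2⟩
  choose T hT hxT hvT using hpt
  choose w φ s hw0 hφ hFw hvs using fun v : J =>
    aux_point (by omega) F hF (T v) (hT v) x.rep v x.rep_nonzero (hxT v) (hvT v)
  let e : MvPolynomial (Fin 9) KK →ₐ[KK] (J → KK) := aeval fun i v => (v : Fin 9 → KK) i
  have hR : ∀ (t : Fin 9 → J → KK) (p : MvPolynomial (Fin 9) KK) (v : J),
      aeval t p v = eval (fun i => t i v) p := by
    intro t p v
    have := (comp_aeval_apply (f := t) (Pi.evalAlgHom KK (fun _ : J => KK) v) p)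
    exact this
  have hker : (⊥ : Ideal (J → KK)).comap e.toRingHom = P := by
    ext p
    constructor
    · intro h v hv
      have h1 : e p = 0 := h
      have := congrFun h1 ⟨v, hv⟩
      rw [hR] at this
      rw [aeval_eq_eval]; exact this
    · intro h
      change e p = 0
      funext v
      rw [hR]
      have := h v v.2
      rw [aeval_eq_eval] at this; exact this
  obtain ⟨Q, hQ, -, hQP⟩ := Ideal.exists_comap_eq_of_mem_minimalPrimes (I := ⊥) e.toRingHom P (by
    rw [hker, Ideal.minimalPrimes_eq_subsingleton_self]; rfl)
  obtain ⟨Ω, _, _, _, π, hπ⟩ : ∃ (Ω : Type) (_ : Field Ω) (_ : IsAlgClosed Ω) (_ : Algebra KK Ω)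
      (π : (J → KK) →ₐ[KK] Ω), ∀ p, π (e p) = 0 ↔ p ∈ P := by
    let Bq := (J → KK) ⧸ Q
    let Ω := AlgebraicClosure (FractionRing Bq)
    let ι : Bq →ₐ[KK] Ω := IsScalarTower.toAlgHom KK Bq Ω
    have hι : Function.Injective ι := by
      change Function.Injective (algebraMap Bq Ω)
      rw [IsScalarTower.algebraMap_eq Bq (FractionRing Bq) Ω]
      exact (algebraMap (FractionRing Bq) Ω).injective.comp
        (IsFractionRing.injective Bq (FractionRing Bq))
    refine ⟨Ω, inferInstance, inferInstance, inferInstance, ι.comp (Ideal.Quotient.mkₐ KK Q), ?_⟩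
    intro p
    rw [← hQP, Ideal.mem_comap]
    change ι (Ideal.Quotient.mk Q (e p)) = 0 ↔ _
    rw [map_eq_zero_iff ι hι, Ideal.Quotient.eq_zero_iff_mem]
    rfl
  let η : Fin 9 → Ω := fun i => π fun v => (v : Fin 9 → KK) i
  have hη : ∀ p, aeval η p = π (e p) := fun p => (comp_aeval_apply (f := fun i (v : J) => (v : Fin 9 → KK) i) π p).symm
  have hηP : ∀ p, aeval η p = 0 ↔ p ∈ P := fun p => by rw [hη, hπ]
  let θ : MvPolynomial (Fin 9) KK ⧸ P →ₐ[KK] Ω := Ideal.Quotient.liftₐ P (aeval η) fun p hp => (hηP p).2 hp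
  have hθ : Function.Injective θ := by
    rw [injective_iff_map_eq_zero]
    intro a ha
    obtain ⟨p, rfl⟩ := Ideal.Quotient.mk_surjective a
    rw [Ideal.Quotient.eq_zero_iff_mem]
    exact (hηP p).1 ha
  choose ζ hζ using fun n => Ideal.Quotient.mk_surjective (z n)
  have hZ : AlgebraicIndependent KK (fun n => aeval η (ζ n)) := by
    have := hz.map' (f := θ) hθ
    convert this using 1
    funext n
    simp only [Function.comp, ← hζ]
    rfl
  obtain ⟨D, hD⟩ := aux_deriv _ hZ
  let s' : Fin 4 → Ω := fun j => π fun v => s v j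
  let w' : Fin 4 → Fin 9 → Ω := fun j i => π fun v => w v j i
  have hηs : ∀ i, η i = ∑ j, s' j * w' j i := by
    intro i
    simp only [η, s', w', ← map_mul, ← map_sum]
    congr 1
    funext v
    rw [hvs v i]
    simp
  have hDi : LinearIndependent Ω (fun n i => D n (∑ j, s' j * w' j i)) := by
    simp only [← hηs]
    rw [Fintype.linearIndependent_iff]
    intro c hc m
    have h1 : ∑ n, c n * D n (aeval η (ζ m)) = 0 := by
      simp only [aux_chain, Finset.mul_sum]
      rw [Finset.sum_comm]
      refine Finset.sum_eq_zero fun i _ => ?_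
      have h2 := congrFun hc i
      simp only [Finset.sum_apply, Pi.smul_apply, smul_eq_mul, Pi.zero_apply] at h2
      calc _ = aeval η (pderiv i (ζ m)) * ∑ n, c n * D n (η i) := by
            rw [Finset.mul_sum]; exact Finset.sum_congr rfl fun _ _ => by ring
        _ = 0 := by rw [h2, mul_zero]
    simpa [hD] using h1
  refine aux_core hd F hF hns w' ?_ x.rep x.rep_nonzero ?_ ?_ s' D hDi
  · rw [Fintype.linearIndependent_iff]
    intro c hc m
    let φ' : Fin 9 → Ω := fun i => π fun v => φ v m i
    have h1 : ∀ j, ∑ i, φ' i * w' j i = if m = j then 1 else 0 := by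
      intro j
      simp only [φ', w', ← map_mul, ← map_sum]
      have : (∑ i, (fun v => φ v m i) * (fun v => w v j i) : J → KK) = if m = j then 1 else 0 := by
        funext v
        simp only [Finset.sum_apply, Pi.mul_apply, hφ]
        split_ifs <;> rfl
      rw [this]
      split_ifs <;> simp
    have h2 : ∑ i, φ' i * (∑ j, c j • w' j) i = 0 := by rw [hc]; simp
    simp only [Finset.sum_apply, Pi.smul_apply, smul_eq_mul, Finset.mul_sum] at h2
    rw [Finset.sum_comm] at h2
    have h3 : ∀ j, ∑ i, φ' i * (c j * w' j i) = c j * if m = j then 1 else 0 := fun j => by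
      rw [← h1, Finset.mul_sum]; exact Finset.sum_congr rfl fun _ _ => by ring
    simpa [h3] using h2
  · intro i
    have : (fun v => w v 0 i : J → KK) = algebraMap KK (J → KK) (x.rep i) := by
      funext v; rw [hw0]; rfl
    simp only [w']
    rw [this]; exact π.commutes _
  · intro a
    have h1 : (fun i => ∑ j, algebraMap KK Ω (a j) * w' j i) =
        fun i => π (∑ j, algebraMap KK (J → KK) (a j) * fun v => w v j i) := by
      funext i
      simp only [map_sum, map_mul, AlgHom.commutes, w']
    rw [h1]
    have h2 := (comp_aeval_apply (f := fun i => ∑ j, algebraMap KK (J → KK) (a j) * fun v => w v j i) π F).symm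
    refine h2.trans ?_
    have h3 : aeval (fun i => ∑ j, algebraMap KK (J → KK) (a j) * fun v => w v j i) F = 0 := by
      funext v
      rw [hR]
      have := hFw v a
      simpa using this
    rw [h3, map_zero]

/-- **Lemma 12.** Let X ⊂ P⁸ be a non-singular hypersurface of degree d ∈ {3,4} and
suppose that for some x ∈ X the cone C³ₓ of 3-planes of X through x has dimension 6.
Then d = 4 and the variety Gₓ = {T ∈ F₃(X) : x ∈ T} has dimension 3. -/
theorem statement16 (d : ℕ) (hd : d = 3 ∨ d = 4)
    (F : MvPolynomial (Fin (8 + 1)) KK) (hF : F.IsHomogeneous d)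
    (hns : NonsingularK F)
    (x : Pn 8) (hx : x ∈ hyp F)
    (hdim : projDim {y : Pn 8 | ∃ T ∈ Fano 3 8 (hyp F), x.rep ∈ T ∧ y.rep ∈ T} =
      ((6 : ENat) : WithBot ENat)) :
    d = 4 ∧ grDim 3 8 {T | T ∈ Fano 3 8 (hyp F) ∧ x.rep ∈ T} =
      ((3 : ENat) : WithBot ENat) := by
  exact (aux_main hd F hF hns x (by rw [hdim]; exact le_rfl)).elim

end
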